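/- arXiv:0910.0732 — 2 statements merged into one kernel-verified Lean document; each statement's English description precedes it below -/
import Mathlib

section
/- There exists i₀ ∈ ℕ such that for all i ≥ i₀ and every integer n with n ≥ (15 − 16·3^{i−1} + 1025·9^{i−2} + 1584·27^{i−2} + 576·81^{i−2} − 8i)/32, the symmetric group S_n has at least 2^i irreducible complex characters of the same degree, i.e., m(S_n) ≥ 2^i. -/
open CategoryTheory Module

/-- Isomorphism-equivalence on irreducible `d`-dimensional complex representations of `G`. -/
def irrSetoid (G : Type) [Group G] (d : ℕ) :
    Setoid {ρ : FDRep ℂ G // Simple ρ ∧ finrank ℂ ρ = d} where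
  r x y := Nonempty (x.1 ≅ y.1)
  iseqv := ⟨fun _ => ⟨Iso.refl _⟩, fun ⟨e⟩ => ⟨e.symm⟩, fun ⟨e⟩ ⟨f⟩ => ⟨e.trans f⟩⟩

/-- The number of irreducible complex characters of `G` of degree `d`, i.e. the number of
isomorphism classes of irreducible `d`-dimensional complex representations of `G`. -/
noncomputable def multOfDegree (G : Type) [Group G] (d : ℕ) : ℕ :=
  Nat.card (Quotient (irrSetoid G d))

/-- `m(G)`: the maximal multiplicity of the irreducible complex character degrees of `G`. -/
noncomputable def maxMult (G : Type) [Group G] : ℕ :=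
  sSup (Set.range (multOfDegree G))

section PartOne
open Matrix Finset

lemma homog_expand {R : Type*} [CommRing R] {ι : Type*} [DecidableEq ι] (s : Finset ι) (x : ι → R) (S T : R) :
    ∏ l ∈ s, (S - x l * T) =
      ∑ m ∈ range (s.card + 1), (∑ t ∈ powersetCard m s, ∏ l ∈ t, (- x l)) * (T ^ m * S ^ (s.card - m)) := by
  have h : ∀ l, S - x l * T = (- x l) * T + S := fun l => by ring
  simp_rw [h]
  rw [prod_add, sum_powerset]
  refine sum_congr rfl fun m hm => ?_
  rw [sum_mul]
  refine sum_congr rfl fun t ht => ?_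
  rw [mem_powersetCard] at ht
  rw [prod_mul_distrib, prod_const, prod_const, card_sdiff_of_subset ht.1, ht.2]
  ring

lemma prod_offdiag {R : Type*} [CommRing R] {k : ℕ} (f : Fin k → Fin k → R) :
    ∏ i, ∏ l ∈ univ.erase i, f i l = (∏ i, ∏ j ∈ Ioi i, f i j) * (∏ i, ∏ j ∈ Ioi i, f j i) := by
  have h : ∀ i : Fin k, (univ.erase i) = Ioi i ∪ Iio i := by
    intro i; ext j
    simp only [mem_erase, mem_univ, and_true, mem_union, mem_Ioi, mem_Iio]
    rw [ne_comm, ne_iff_lt_or_gt]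
  have hd : ∀ i : Fin k, Disjoint (Ioi i) (Iio i) := by
    intro i; rw [Finset.disjoint_left]; intro j; simp; intro h; exact h.le
  simp_rw [h, prod_union (hd _), prod_mul_distrib]
  congr 1
  rw [prod_comm' (s := univ) (t := fun i => Iio i) (t' := univ) (s' := fun i => Ioi i)]
  simp

theorem cauchy_det {R : Type*} [CommRing R] [IsDomain R] {k : ℕ} (x y : Fin k → R)
    (hx : Function.Injective x) :
    (Matrix.of fun i j => ∏ l ∈ univ.erase i, (1 - x l * y j)).det =
      (vandermonde x).det * (vandermonde y).det := by
  cases k with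
  | zero => simp
  | succ k =>
  let Q : Matrix (Fin (k+1)) (Fin (k+1)) R :=
    Matrix.of fun i m => ∑ t ∈ powersetCard (m : ℕ) (univ.erase i), ∏ l ∈ t, (- x l)
  have key : ∀ S T : Fin (k+1) → R, 
      (Matrix.of fun i j => ∏ l ∈ univ.erase i, (S j - x l * T j)) = Q * (projVandermonde T S)ᵀ := by
    intro S T
    ext i j
    simp only [of_apply, mul_apply, transpose_apply, projVandermonde_apply, Q]
    rw [homog_expand]
    simp only [card_erase_of_mem (mem_univ _), card_univ, Fintype.card_fin, Nat.add_sub_cancel]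
    rw [← Fin.sum_univ_eq_sum_range (fun m => (∑ t ∈ powersetCard m (univ.erase i), ∏ l ∈ t, (- x l)) * (T j ^ m * S j ^ (k - m)))]
    refine sum_congr rfl fun m _ => ?_
    simp only [Fin.val_rev]
    congr 3; omega
  have h1 := congrArg det (key x (fun _ => 1))
  have hdiag : (Matrix.of fun i j => ∏ l ∈ univ.erase i, (x j - x l * (1 : R))) =
      diagonal fun i => ∏ l ∈ univ.erase i, (x i - x l) := by
    ext i j
    by_cases h : i = j
    · subst h; simp
    · simp only [of_apply, diagonal_apply, h, if_false]
      exact prod_eq_zero (i := j) (by simp [Ne.symm h]) (by simp)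
  rw [hdiag, det_diagonal, det_mul, det_transpose, det_projVandermonde, prod_offdiag] at h1
  have hne : (∏ i : Fin (k+1), ∏ j ∈ Ioi i, (x i - x j)) ≠ 0 := by
    refine prod_ne_zero_iff.2 fun i _ => prod_ne_zero_iff.2 fun j hj => ?_
    rw [sub_ne_zero]; exact fun h => (mem_Ioi.1 hj).ne (hx h)
  simp only [one_mul] at h1
  have h2 : Q.det = ∏ i : Fin (k+1), ∏ j ∈ Ioi i, (x j - x i) := by
    apply mul_right_cancel₀ hne; rw [← h1]; ring
  have h3 := congrArg det (key (fun _ => 1) y)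
  rw [h3, det_mul, det_transpose, det_projVandermonde, h2, det_vandermonde, det_vandermonde]
  simp

section Colorings
variable {J : Type*} [Fintype J] [DecidableEq J]

/-- content of a colouring -/
noncomputable def cnt {n : ℕ} (f : Fin n → J) : J →₀ ℕ := ∑ a, Finsupp.single (f a) 1

lemma cnt_apply {n : ℕ} (f : Fin n → J) (c : J) : cnt f c = Fintype.card {a // f a = c} := by
  simp [cnt, Finsupp.finsetSum_apply, Finsupp.single_apply, Fintype.card_subtype]

lemma sum_cnt {n : ℕ} (f : Fin n → J) : ∑ c, cnt f c = n := by
  simp only [cnt, Finsupp.finsetSum_apply]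
  rw [sum_comm]; simp [Finsupp.single_apply]

lemma prod_cnt {R : Type*} [CommRing R] {n : ℕ} (f : Fin n → J) (z : J → R) :
    ∏ a, z (f a) = ∏ c, z c ^ cnt f c := by
  simp only [cnt, Finsupp.finsetSum_apply, ← prod_pow_eq_pow_sum]
  rw [prod_comm]
  refine prod_congr rfl fun a _ => ?_
  rw [prod_eq_single (f a)] <;> simp +contextual [Finsupp.single_apply, eq_comm]

lemma prod_X_cnt {n : ℕ} (f : Fin n → J) :
    ∏ a, (MvPolynomial.X (f a) : MvPolynomial J ℤ) = MvPolynomial.monomial (cnt f) 1 := by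
  rw [prod_cnt f (fun c => (MvPolynomial.X c : MvPolynomial J ℤ)), MvPolynomial.monomial_eq]
  simp [Finsupp.prod_fintype]

lemma card_cnt {n : ℕ} (m : J →₀ ℕ) (hm : ∑ c, m c = n) :
    (univ.filter fun f : Fin n → J => cnt f = m).card * ∏ c, (m c).factorial = n.factorial := by
  have h1 : (∑ c : J, (MvPolynomial.X c : MvPolynomial J ℤ)) ^ n =
      ∑ f : Fin n → J, MvPolynomial.monomial (cnt f) 1 := by
    rw [Fintype.sum_pow]
    exact sum_congr rfl fun f _ => prod_X_cnt f
  have h2 := congrArg (MvPolynomial.coeff m) h1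
  rw [sum_pow_eq_sum_piAntidiag] at h2
  simp only [MvPolynomial.coeff_sum, MvPolynomial.coeff_monomial] at h2
  rw [sum_boole] at h2
  have h3 : ∀ l : J → ℕ, ∏ c, (MvPolynomial.X c : MvPolynomial J ℤ) ^ l c =
      MvPolynomial.monomial (Finsupp.equivFunOnFinite.symm l) 1 := by
    intro l
    rw [MvPolynomial.monomial_eq]; simp [Finsupp.prod_fintype]
  simp only [h3, ← MvPolynomial.C_eq_coe_nat, MvPolynomial.coeff_C_mul, MvPolynomial.coeff_monomial] at h2
  rw [sum_eq_single (m : J → ℕ)] at h2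
  · have h4 : Finsupp.equivFunOnFinite.symm (m : J → ℕ) = m := by ext; simp
    simp only [h4, if_true, mul_one] at h2
    have h5 := Nat.multinomial_spec univ (m : J → ℕ)
    rw [hm] at h5
    rw [← h5, mul_comm]; congr 1
    exact_mod_cast h2.symm
  · intro l _ hl
    rw [if_neg, mul_zero]
    rintro rfl
    exact hl (by ext; simp)
  · intro h
    exact absurd (by simp [hm]) h

/-- power sum attached to a permutation -/
def PP {R : Type*} [CommRing R] {n : ℕ} (g : Equiv.Perm (Fin n)) (z : J → R) : R :=
  ∑ f : Fin n → J with f ∘ g = f, ∏ a, z (f a)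

lemma sum_PP {R : Type*} [CommRing R] {n : ℕ} (z : J → R) :
    ∑ g : Equiv.Perm (Fin n), PP g z =
      (n.factorial : R) * ∑ m ∈ finsuppAntidiag (univ : Finset J) n, ∏ c, z c ^ m c := by
  unfold PP
  simp_rw [sum_filter]
  rw [sum_comm]
  have h1 : ∀ f : Fin n → J, (∑ g : Equiv.Perm (Fin n), if f ∘ g = f then ∏ a, z (f a) else 0) =
      ((∏ c, (cnt f c).factorial : ℕ) : R) * ∏ c, z c ^ cnt f c := by
    intro f
    rw [← sum_filter, sum_const, nsmul_eq_mul, ← prod_cnt]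
    congr 2
    rw [← Fintype.card_subtype, DomMulAct.stabilizer_card]
    exact prod_congr rfl fun c _ => by rw [cnt_apply]
  simp_rw [h1]
  rw [← sum_fiberwise_of_maps_to (t := finsuppAntidiag (univ : Finset J) n) (g := cnt)]
  · rw [mul_sum]
    refine sum_congr rfl fun m hm => ?_
    rw [mem_finsuppAntidiag] at hm
    rw [sum_congr rfl (g := fun _ => ((∏ c, (m c).factorial : ℕ) : R) * ∏ c, z c ^ m c)]
    · rw [sum_const, nsmul_eq_mul, ← mul_assoc, ← Nat.cast_mul, card_cnt m hm.1]
    · intro f hf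
      rw [(mem_filter.1 hf).2]
  · intro f _
    rw [mem_finsuppAntidiag]
    exact ⟨sum_cnt f, by simp⟩

lemma PP_mul {R : Type*} [CommRing R] {A B : Type*} [Fintype A] [Fintype B] [DecidableEq A]
    [DecidableEq B] {n : ℕ} (g : Equiv.Perm (Fin n))
    (x : A → R) (y : B → R) :
    PP g (fun p : A × B => x p.1 * y p.2) = PP g x * PP g y := by
  unfold PP
  rw [sum_mul_sum, ← sum_product']
  refine sum_bij' (fun f _ => (fun a => (f a).1, fun a => (f a).2)) (fun p _ a => (p.1 a, p.2 a)) ?_ ?_ ?_ ?_ ?_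
  · intro f hf
    simp only [mem_filter, mem_univ, true_and, mem_product] at hf ⊢
    exact ⟨funext fun a => congrArg Prod.fst (congrFun hf a), funext fun a => congrArg Prod.snd (congrFun hf a)⟩
  · intro f hf
    simp only [mem_filter, mem_univ, true_and, mem_product] at hf ⊢
    exact funext fun a => Prod.ext (congrFun hf.1 a) (congrFun hf.2 a)
  · intro f _; rfl
  · intro f _; rfl
  · intro f _; simp [prod_mul_distrib]

lemma PP_map {R R' : Type*} [CommRing R] [CommRing R'] (φ : R →+* R') {n : ℕ} (g : Equiv.Perm (Fin n))
    (z : J → R) : PP g (fun c => φ (z c)) = φ (PP g z) := by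
  simp [PP, map_sum, map_prod]

lemma PP_inv {R : Type*} [CommRing R] {n : ℕ} (g : Equiv.Perm (Fin n)) (z : J → R) :
    PP g⁻¹ z = PP g z := by
  unfold PP
  congr 1
  ext f
  simp only [mem_filter, mem_univ, true_and]
  constructor
  · intro h; conv_lhs => rw [← h]
    ext a; simp
  · intro h; conv_lhs => rw [← h]
    ext a; simp

end Colorings

section PS
variable {S : Type*} [CommRing S]

/-- geometric series -/
noncomputable def GG (u : S) : PowerSeries S := PowerSeries.mk fun m => u ^ m

lemma GG_mul (u : S) : (1 - PowerSeries.C u * PowerSeries.X) * GG u = 1 := by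
  ext m
  rw [sub_mul, one_mul, mul_assoc]
  cases m with
  | zero => simp [GG]
  | succ m =>
    rw [map_sub, PowerSeries.coeff_C_mul, PowerSeries.coeff_succ_X_mul]
    simp [GG, PowerSeries.coeff_one, pow_succ']

/-- number of pairs -/
def ee (k : ℕ) : ℕ := ∑ i : Fin k, (Ioi i).card

theorem cauchyPS [IsDomain S] {k : ℕ} (x y : Fin k → S) (hx : Function.Injective x) :
    ∑ σ : Equiv.Perm (Fin k), (Equiv.Perm.sign σ) • ∏ i, GG (x (σ i) * y i) =
      PowerSeries.C ((vandermonde x).det * (vandermonde y).det) * PowerSeries.X ^ (ee k) *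
        ∏ p : Fin k × Fin k, GG (x p.1 * y p.2) := by
  have hinj : Function.Injective fun i => PowerSeries.C (x i) * (PowerSeries.X : PowerSeries S) := by
    intro i j h
    apply hx
    have := congrArg (PowerSeries.coeff 1) h
    simpa using this
  have h := cauchy_det (fun i => PowerSeries.C (x i) * (PowerSeries.X : PowerSeries S))
    (fun i => PowerSeries.C (y i)) hinj
  have hx' : (vandermonde fun i => PowerSeries.C (x i) * (PowerSeries.X : PowerSeries S)).det =
      PowerSeries.C (vandermonde x).det * PowerSeries.X ^ (ee k) := by
    simp only [det_vandermonde, map_prod, map_sub, ← sub_mul, prod_mul_distrib, prod_const, ee,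
      prod_pow_eq_pow_sum]
  have hy' : (vandermonde fun i => (PowerSeries.C (y i) : PowerSeries S)).det =
      PowerSeries.C (vandermonde y).det := by
    simp only [det_vandermonde, map_prod, map_sub]
  rw [hx', hy', det_apply] at h
  have h2 := congrArg (· * ∏ p : Fin k × Fin k, GG (x p.1 * y p.2)) h
  rw [sum_mul] at h2
  rw [map_mul]
  refine Eq.trans ?_ (h2.trans (by ring))
  refine sum_congr rfl fun σ _ => ?_
  rw [smul_mul_assoc]
  congr 1
  rw [Fintype.prod_prod_type_right, ← prod_mul_distrib]
  refine prod_congr rfl fun i _ => ?_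
  rw [← mul_prod_erase univ _ (mem_univ (σ i)), of_apply, mul_left_comm, ← prod_mul_distrib]
  rw [prod_eq_one, mul_one]
  intro l _
  refine Eq.trans ?_ (GG_mul (x l * y i))
  rw [map_mul]; ring

theorem cauchy_coeff [IsDomain S] {k : ℕ} (n : ℕ) (x y : Fin k → S) (hx : Function.Injective x) :
    ∑ σ : Equiv.Perm (Fin k), (Equiv.Perm.sign σ) • ∑ m ∈ finsuppAntidiag univ (n + ee k),
        ∏ i, (x (σ i) * y i) ^ m i =
      ((vandermonde x).det * (vandermonde y).det) * 
        ∑ m ∈ finsuppAntidiag (univ : Finset (Fin k × Fin k)) n, ∏ p, (x p.1 * y p.2) ^ m p := by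
  have h := congrArg (PowerSeries.coeff (n + ee k)) (cauchyPS x y hx)
  rw [mul_assoc, PowerSeries.coeff_C_mul, PowerSeries.coeff_X_pow_mul, PowerSeries.coeff_prod, map_sum] at h
  simp only [GG, PowerSeries.coeff_mk] at h
  rw [← h]
  refine sum_congr rfl fun σ _ => ?_
  rw [Units.smul_def, Units.smul_def, map_zsmul, PowerSeries.coeff_prod]
  simp

end PS

section Chi
open MvPolynomial

/-- The (virtual) character attached to a beta set. -/
noncomputable def chi {k n : ℕ} (a : Fin k →₀ ℕ) (g : Equiv.Perm (Fin n)) : ℤ :=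
  coeff a ((vandermonde (X : Fin k → MvPolynomial (Fin k) ℤ)).det *
    PP g (X : Fin k → MvPolynomial (Fin k) ℤ))

lemma coeff_coeff {k : ℕ} (p q : MvPolynomial (Fin k) ℤ) (a b : Fin k →₀ ℕ) :
    coeff b (coeff a (map (C : ℤ →+* MvPolynomial (Fin k) ℤ) p * C q)) = coeff a p * coeff b q := by
  rw [mul_comm, coeff_C_mul, coeff_map, mul_comm, coeff_C_mul]

lemma prod_X_pow_monomial {k : ℕ} {R : Type*} [CommRing R] (m : Fin k →₀ ℕ) (σ : Equiv.Perm (Fin k)) :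
    ∏ i, (X (σ i) : MvPolynomial (Fin k) R) ^ m i = monomial (m.equivMapDomain σ) 1 := by
  rw [monomial_eq, Finsupp.prod_fintype _ _ (by simp), map_one, one_mul]
  refine Eq.trans ?_ (Equiv.prod_comp σ _)
  simp

lemma strictMono_perm {k : ℕ} (a b : Fin k → ℕ) (ha : StrictMono a) (hb : StrictMono b)
    (σ : Equiv.Perm (Fin k)) (h : ∀ i, b i = a (σ i)) : σ = 1 := by
  have h1 : StrictMono σ := by
    intro i j hij
    have := hb hij
    rw [h, h] at this
    exact ha.lt_iff_lt.1 this
  have : (σ : Fin k → Fin k) = id := by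
    have := Subsingleton.elim (α := Fin k ≃o Fin k) (h1.orderIsoOfSurjective σ σ.surjective) (OrderIso.refl _)
    funext i
    exact congrArg (fun e : Fin k ≃o Fin k => e i) this
  ext i; simp [this]

lemma eqmd_one {k : ℕ} (m : Fin k →₀ ℕ) : m.equivMapDomain (1 : Equiv.Perm (Fin k)) = m := by
  ext; rfl

theorem chi_orth {k n : ℕ} (a b : Fin k →₀ ℕ) (ha : StrictMono a) (hb : StrictMono b)
    (hn : ∑ i, a i = n + ee k) (hn' : ∑ i, b i = n + ee k) :
    ∑ g : Equiv.Perm (Fin n), chi a g * chi b g = if a = b then (n.factorial : ℤ) else 0 := by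
  classical
  let x : Fin k → MvPolynomial (Fin k) (MvPolynomial (Fin k) ℤ) := X
  let y : Fin k → MvPolynomial (Fin k) (MvPolynomial (Fin k) ℤ) := fun j => C (X j)
  have hx : Function.Injective x := X_injective
  have h := cauchy_coeff n x y hx
  have h2 := congrArg (fun F => (n.factorial : MvPolynomial (Fin k) (MvPolynomial (Fin k) ℤ)) * F) h
  rw [mul_left_comm, ← sum_PP (fun p : Fin k × Fin k => x p.1 * y p.2),
    mul_sum univ (fun g => PP g (fun p : Fin k × Fin k => x p.1 * y p.2))] at h2
  have hvx : (vandermonde x).det = map C (vandermonde (X : Fin k → MvPolynomial (Fin k) ℤ)).det := by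
    simp [det_vandermonde, map_prod, x]
  have hvy : (vandermonde y).det = C (vandermonde (X : Fin k → MvPolynomial (Fin k) ℤ)).det := by
    simp [det_vandermonde, map_prod, y]
  have hPx : ∀ g : Equiv.Perm (Fin n), PP g x = map C (PP g (X : Fin k → MvPolynomial (Fin k) ℤ)) := by
    intro g; rw [← PP_map]; simp [x]
  have hPy : ∀ g : Equiv.Perm (Fin n), PP g y = C (PP g (X : Fin k → MvPolynomial (Fin k) ℤ)) := by
    intro g; rw [← PP_map]
  have h3 := congrArg (fun F => coeff b (coeff a F)) h2
  beta_reduce at h3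
  conv_rhs at h3 => rw [coeff_sum, coeff_sum]
  have h4 : ∀ g : Equiv.Perm (Fin n), coeff b (coeff a ((vandermonde x).det * (vandermonde y).det *
      PP g (fun p : Fin k × Fin k => x p.1 * y p.2))) = chi a g * chi b g := by
    intro g
    rw [PP_mul, hvx, hvy, hPx, hPy, mul_mul_mul_comm, ← map_mul, ← map_mul, coeff_coeff]
    rfl
  simp only [h4] at h3
  rw [← h3]
  have hcast : ∀ F : MvPolynomial (Fin k) (MvPolynomial (Fin k) ℤ),
      coeff b (coeff a ((n.factorial : MvPolynomial (Fin k) (MvPolynomial (Fin k) ℤ)) * F)) =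
        n.factorial * coeff b (coeff a F) := by
    intro F
    rw [← nsmul_eq_mul, coeff_smul, coeff_smul, nsmul_eq_mul]
  rw [hcast, coeff_sum, coeff_sum]
  have h5 : ∀ σ : Equiv.Perm (Fin k), coeff b (coeff a (Equiv.Perm.sign σ •
      ∑ m ∈ finsuppAntidiag univ (n + ee k), ∏ i, (x (σ i) * y i) ^ m i)) =
        if σ = 1 ∧ a = b then 1 else 0 := by
    intro σ
    rw [Units.smul_def, coeff_smul, coeff_smul, coeff_sum, coeff_sum]
    have h6 : ∀ m : Fin k →₀ ℕ, coeff b (coeff a (∏ i, (x (σ i) * y i) ^ m i)) =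
        if m.equivMapDomain σ = a ∧ m = b then 1 else 0 := by
      intro m
      have e1 : ∏ i, (x (σ i) * y i) ^ m i =
          map C (monomial (m.equivMapDomain σ) (1 : ℤ)) * C (monomial m 1) := by
        have e2 : (monomial m (1 : ℤ)) = ∏ i, (X i : MvPolynomial (Fin k) ℤ) ^ m i := by
          have := prod_X_pow_monomial (R := ℤ) m 1
          rw [eqmd_one] at this
          exact this.symm
        rw [e2, map_prod]
        simp only [mul_pow, prod_mul_distrib, x, y, map_pow]
        rw [prod_X_pow_monomial, map_monomial, RingHom.map_one]
      rw [e1, coeff_coeff, coeff_monomial, coeff_monomial]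
      by_cases h1 : m.equivMapDomain σ = a <;> by_cases h2 : m = b
      · rw [if_pos h1, if_pos h2, if_pos ⟨h1, h2⟩]; rfl
      · rw [if_neg h2, mul_zero, if_neg (fun h => h2 h.2)]
      · rw [if_neg h1, zero_mul, if_neg (fun h => h1 h.1)]
      · rw [if_neg h1, zero_mul, if_neg (fun h => h1 h.1)]
    simp only [h6]
    split_ifs with hc
    · obtain ⟨rfl, rfl⟩ := hc
      rw [sum_eq_single a]
      · simp [eqmd_one]
      · intro m _ hm; simp [hm]
      · intro hm; exact absurd (by rw [mem_finsuppAntidiag]; exact ⟨hn, by simp⟩) hm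
    · rw [sum_eq_zero, smul_zero]
      intro m _
      rw [if_neg]
      rintro ⟨h7, rfl⟩
      have : σ = 1 := strictMono_perm a m ha hb σ (fun i => by rw [← h7]; simp)
      subst this
      exact hc ⟨rfl, by rw [← h7, eqmd_one]⟩
  simp only [h5]
  by_cases hab : a = b <;> simp [hab]

end Chi

section Degree
open MvPolynomial

/-- exponent of the Vandermonde term -/
noncomputable def ev {k : ℕ} (σ : Equiv.Perm (Fin k)) : Fin k →₀ ℕ :=
  Finsupp.equivFunOnFinite.symm (fun i => ((σ.symm i : Fin k) : ℕ))

lemma ev_apply {k : ℕ} (σ : Equiv.Perm (Fin k)) (i : Fin k) : ev σ i = (σ.symm i : Fin k) := rfl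

lemma ee_eq (k : ℕ) : ee k = ∑ i : Fin k, (i : ℕ) := by
  unfold ee
  rw [← Equiv.sum_comp Fin.revPerm]
  refine sum_congr rfl fun i _ => ?_
  rw [Fin.card_Ioi]; simp [Fin.val_rev]; omega

lemma coeff_PP {k n : ℕ} (g : Equiv.Perm (Fin n)) (m : Fin k →₀ ℕ) :
    coeff m (PP g (X : Fin k → MvPolynomial (Fin k) ℤ)) =
      ((univ.filter fun f : Fin n → Fin k => f ∘ g = f ∧ cnt f = m).card : ℤ) := by
  unfold PP
  rw [coeff_sum, ← filter_filter, card_filter, Nat.cast_sum]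
  refine sum_congr rfl fun f _ => ?_
  rw [prod_X_cnt, coeff_monomial]
  simp

lemma chi_expand {k n : ℕ} (a : Fin k →₀ ℕ) (g : Equiv.Perm (Fin n)) :
    chi a g = ∑ σ : Equiv.Perm (Fin k), ((Equiv.Perm.sign σ : ℤˣ) : ℤ) *
      (if ev σ ≤ a then
        ((univ.filter fun f : Fin n → Fin k => f ∘ g = f ∧ cnt f = a - ev σ).card : ℤ) else 0) := by
  unfold chi
  rw [det_apply, sum_mul, coeff_sum]
  refine sum_congr rfl fun σ _ => ?_
  rw [smul_mul_assoc, Units.smul_def, coeff_smul, smul_eq_mul]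
  congr 1
  have : ∏ i, vandermonde (X : Fin k → MvPolynomial (Fin k) ℤ) (σ i) i = monomial (ev σ) 1 := by
    have := prod_X_pow_monomial (R := ℤ) (Finsupp.equivFunOnFinite.symm (fun i : Fin k => (i : ℕ))) σ
    simp only [vandermonde_apply]
    refine Eq.trans ?_ (this.trans ?_)
    · rfl
    · congr 2; ext i; rfl
  rw [this, coeff_monomial_mul', one_mul, coeff_PP]

theorem chi_one {k n : ℕ} (a : Fin k →₀ ℕ) (hn : ∑ i, a i = n + ee k) :
    (chi a (1 : Equiv.Perm (Fin n)) : ℤ) * ∏ i, ((a i).factorial : ℤ) =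
      n.factorial * (vandermonde (fun i => (a i : ℤ))).det := by
  rw [det_eval_matrixOfPolynomials_eq_det_vandermonde _ (fun j => descPochhammer ℤ (j : ℕ))
    (fun i => descPochhammer_natDegree _ _) (fun i => monic_descPochhammer _ _), det_apply,
    chi_expand, sum_mul, mul_sum]
  refine sum_congr rfl fun σ _ => ?_
  rw [Units.smul_def, smul_eq_mul, mul_left_comm, mul_assoc]
  congr 1
  simp only [of_apply, descPochhammer_eval_eq_descFactorial]
  have h0 : ∏ i, (((a (σ i)).descFactorial (i : ℕ) : ℕ) : ℤ) =
      ∏ i, (((a i).descFactorial (σ.symm i : Fin k) : ℕ) : ℤ) := by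
    rw [← Equiv.prod_comp σ.symm]
    simp only [Equiv.apply_symm_apply]
  rw [h0]
  split_ifs with h
  · have h1 := card_cnt (n := n) (a - ev σ) (by
      have e1 : ∑ i, ev σ i = ee k := by
        rw [ee_eq]; simp only [ev_apply]; exact Equiv.sum_comp σ.symm (fun i => (i : ℕ))
      have e2 : ∑ c, (a - ev σ) c + ∑ i, ev σ i = ∑ i, a i := by
        rw [← sum_add_distrib]
        exact sum_congr rfl fun i _ => by
          have := h i
          simp only [Finsupp.tsub_apply]; omega
      omega)
    have h2 : (univ.filter fun f : Fin n → Fin k => f ∘ (1 : Equiv.Perm (Fin n)) = f ∧ cnt f = a - ev σ)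
        = (univ.filter fun f : Fin n → Fin k => cnt f = a - ev σ) := by
      ext f; simp
    rw [h2, ← h1]
    push_cast
    rw [mul_assoc, ← prod_mul_distrib]
    congr 1
    refine prod_congr rfl fun i _ => ?_
    rw [← Nat.factorial_mul_descFactorial (h i), ev_apply]
    push_cast; rfl
  · rw [zero_mul]
    symm
    rw [Finsupp.le_def] at h
    push Not at h
    obtain ⟨i, hi⟩ := h
    rw [prod_eq_zero (mem_univ i), mul_zero]
    rw [ev_apply] at hi
    exact_mod_cast Nat.descFactorial_of_lt hi

lemma chi_one_pos {k n : ℕ} (a : Fin k →₀ ℕ) (ha : StrictMono a) (hn : ∑ i, a i = n + ee k) :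
    0 < chi a (1 : Equiv.Perm (Fin n)) := by
  have h := chi_one a hn
  have h1 : 0 < (vandermonde (fun i => (a i : ℤ))).det := by
    rw [det_vandermonde]
    refine prod_pos fun i _ => prod_pos fun j hj => ?_
    have := ha (mem_Ioi.1 hj)
    omega
  have h2 : (0 : ℤ) < ∏ i, ((a i).factorial : ℤ) :=
    prod_pos fun i _ => by exact_mod_cast Nat.factorial_pos _
  have h3 : (0 : ℤ) < n.factorial := by exact_mod_cast Nat.factorial_pos _
  exact pos_of_mul_pos_left (h ▸ mul_pos h3 h1) h2.le

end Degree

end PartOne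

section RepTheory

/-- the set of irreducible characters -/
def IrrChar (G : Type) [Group G] : Set (G → ℂ) :=
  {φ | ∃ W : FDRep ℂ G, Simple W ∧ W.character = φ}

variable {G : Type} [Group G] [Fintype G]

lemma irr_norm {φ : G → ℂ} (h : φ ∈ IrrChar G) : ∑ g, φ g * φ g⁻¹ = Nat.card G := by
  obtain ⟨W, hW, rfl⟩ := h
  exact (FDRep.simple_iff_char_is_norm_one W).1 hW

lemma irr_iso {V W : FDRep ℂ G} (hV : Simple V) (hW : Simple W) (h : V.character = W.character) :
    Nonempty (V ≅ W) := by
  classical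
  have := invertibleOfNonzero (NeZero.ne (Nat.card G : ℂ))
  have h1 := FDRep.char_orthonormal V W
  have h2 := (FDRep.simple_iff_char_is_norm_one W).1 hW
  rw [h, h2, inv_mul_cancel₀ (NeZero.ne (Nat.card G : ℂ))] at h1
  by_contra hc
  rw [if_neg hc] at h1
  exact one_ne_zero h1

lemma irr_orth {φ ψ : G → ℂ} (h : φ ∈ IrrChar G) (h' : ψ ∈ IrrChar G) (hne : φ ≠ ψ) :
    ∑ g, φ g * ψ g⁻¹ = 0 := by
  classical
  obtain ⟨V, hV, rfl⟩ := h
  obtain ⟨W, hW, rfl⟩ := h'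
  have := invertibleOfNonzero (NeZero.ne (Nat.card G : ℂ))
  have h1 := FDRep.char_orthonormal V W
  rw [if_neg] at h1
  · exact (mul_eq_zero.1 h1).resolve_left (inv_ne_zero (NeZero.ne (Nat.card G : ℂ)))
  · rintro ⟨e⟩
    exact hne (FDRep.char_iso e)

lemma irr_linind : LinearIndependent ℂ (Subtype.val : IrrChar G → (G → ℂ)) := by
  classical
  rw [linearIndependent_iff']
  intro s c hc i hi
  have h1 : ∑ g, (∑ j ∈ s, c j • (j : G → ℂ)) g * (i : G → ℂ) g⁻¹ = 0 := by
    rw [hc]; simp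
  simp only [Finset.sum_apply, Pi.smul_apply, smul_eq_mul, Finset.sum_mul, mul_assoc] at h1
  rw [Finset.sum_comm] at h1
  simp only [← Finset.mul_sum] at h1
  rw [Finset.sum_eq_single i, irr_norm i.2] at h1
  · exact (mul_eq_zero.1 h1).resolve_right (NeZero.ne (Nat.card G : ℂ))
  · intro j _ hj
    rw [irr_orth j.2 i.2 (fun h => hj (Subtype.ext h)), mul_zero]
  · intro h; exact absurd hi h

lemma irr_finite : Finite (IrrChar G) := (irr_linind (G := G)).finite_of_isNoetherian

lemma mult_inj (d : ℕ) : ∃ F : Quotient (irrSetoid G d) → IrrChar G, Function.Injective F ∧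
    ∀ x, F (Quotient.mk _ x) = x.1.character := by
  refine ⟨Quotient.lift (fun x => ⟨x.1.character, x.1, x.2.1, rfl⟩) ?_, ?_, ?_⟩
  · rintro x y ⟨e⟩
    exact Subtype.ext (FDRep.char_iso e)
  · intro x y
    induction x using Quotient.inductionOn
    induction y using Quotient.inductionOn
    rename_i x y
    intro h
    exact Quotient.sound (irr_iso x.2.1 y.2.1 (congrArg Subtype.val h))
  · intro x; rfl

/-- Lower bound for `maxMult` from a family of irreducible characters of the same degree. -/
lemma le_maxMult {ι : Type} [Fintype ι] (φ : ι → (G → ℂ)) (hφ : Function.Injective φ)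
    (hi : ∀ j, φ j ∈ IrrChar G) (d : ℕ) (hd : ∀ j, φ j 1 = d) :
    Fintype.card ι ≤ maxMult G := by
  have := irr_finite (G := G)
  have hfin : ∀ d, Finite (Quotient (irrSetoid G d)) := fun d => by
    obtain ⟨F, hF, _⟩ := mult_inj (G := G) d
    exact Finite.of_injective F hF
  have h1 : multOfDegree G d ≤ maxMult G := by
    refine le_csSup ⟨Nat.card (IrrChar G), ?_⟩ ⟨d, rfl⟩
    rintro _ ⟨e, rfl⟩
    obtain ⟨F, hF, _⟩ := mult_inj (G := G) e
    exact Nat.card_le_card_of_injective F hF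
  refine le_trans ?_ h1
  rw [Fintype.card_eq_nat_card]
  choose W hW hc using hi
  have hdim : ∀ j, finrank ℂ (W j) = d := by
    intro j
    have := FDRep.char_one (W j)
    rw [hc, hd] at this
    exact_mod_cast this.symm
  have := hfin d
  refine Nat.card_le_card_of_injective
    (fun j => (Quotient.mk (irrSetoid G d) ⟨W j, hW j, hdim j⟩ : Quotient (irrSetoid G d))) ?_
  intro j j' hj
  obtain ⟨e⟩ := Quotient.exact hj
  apply hφ
  rw [← hc, ← hc]
  exact FDRep.char_iso e

/-- A virtual character of norm one and positive degree is irreducible. -/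
lemma virtual_irr {φ : G → ℂ} (h : φ ∈ Submodule.span ℤ (IrrChar G))
    (hn : ∑ g, φ g * φ g⁻¹ = Nat.card G) (d : ℕ) (hd : 0 < d) (h1 : φ 1 = d) : φ ∈ IrrChar G := by
  classical
  rw [Submodule.mem_span_set] at h
  obtain ⟨c, hc, rfl⟩ := h
  have key : ∑ g, (c.sum fun mi r => r • mi) g * (c.sum fun mi r => r • mi) g⁻¹ =
      (Nat.card G : ℂ) * ((∑ f ∈ c.support, c f ^ 2 : ℤ) : ℂ) := by
    simp only [Finsupp.sum, Finset.sum_apply, Pi.smul_apply, Finset.sum_mul_sum]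
    rw [Finset.sum_comm]
    push_cast
    rw [Finset.mul_sum]
    refine Finset.sum_congr rfl fun f hf => ?_
    rw [Finset.sum_comm, Finset.sum_eq_single f]
    · rw [← irr_norm (hc hf), Finset.sum_mul]
      refine Finset.sum_congr rfl fun g _ => ?_
      simp only [zsmul_eq_mul]; ring
    · intro f' hf' hne
      have := irr_orth (hc hf) (hc hf') (Ne.symm hne)
      rw [← mul_zero ((c f : ℂ) * c f'), ← this, Finset.mul_sum]
      refine Finset.sum_congr rfl fun g _ => ?_
      simp only [zsmul_eq_mul]; ring
    · intro h; exact absurd hf h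
  rw [hn] at key
  have h2 : (∑ f ∈ c.support, c f ^ 2 : ℤ) = 1 := by
    have := mul_left_cancel₀ (NeZero.ne (Nat.card G : ℂ)) ((mul_one _).trans key)
    exact_mod_cast this.symm
  have h3 : ∀ f ∈ c.support, 1 ≤ c f ^ 2 := by
    intro f hf
    have : 0 < c f ^ 2 := by
      have := Finsupp.mem_support_iff.1 hf
      positivity
    omega
  have h4 : c.support.card = 1 := by
    have h5 : (c.support.card : ℤ) ≤ 1 := by
      rw [← h2]
      simpa using Finset.card_nsmul_le_sum c.support _ 1 h3
    have h6 : c.support.card ≠ 0 := by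
      intro h0
      rw [Finset.card_eq_zero] at h0
      rw [h0] at h2; simp at h2
    omega
  obtain ⟨f, hf⟩ := Finset.card_eq_one.1 h4
  have hfm : f ∈ IrrChar G := hc (by rw [hf]; simp)
  rw [hf, Finset.sum_singleton] at h2
  have hs : (c.sum fun mi r => r • mi) = c f • f := by
    rw [Finsupp.sum, hf, Finset.sum_singleton]
  rw [hs] at h1 ⊢
  rcases mul_self_eq_one_iff.1 ((sq (c f)).symm.trans h2) with h | h
  · rw [h, one_smul]; exact hfm
  · exfalso
    obtain ⟨W, hW, rfl⟩ := hfm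
    rw [h, Pi.smul_apply, FDRep.char_one] at h1
    have h7 : (-1 : ℤ) * (finrank ℂ W : ℤ) = d := by
      rw [zsmul_eq_mul] at h1; exact_mod_cast h1
    omega

/-- Characters are nonnegative integral combinations of irreducible characters. -/
lemma char_mem_span (N : ℕ) : ∀ {V : Type} [AddCommGroup V] [Module ℂ V] [FiniteDimensional ℂ V]
    (ρ : Representation ℂ G V), finrank ℂ V ≤ N → ρ.character ∈ Submodule.span ℤ (IrrChar G) := by
  classical
  induction N with
  | zero =>
    intro V _ _ _ ρ h
    have : Subsingleton V := by
      rw [← Module.finrank_zero_iff (R := ℂ)]; omega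
    have h0 : ρ.character = 0 := by
      funext g
      have : ρ g = 0 := Subsingleton.elim _ _
      simp [Representation.character, this]
    rw [h0]; exact zero_mem _
  | succ N ih =>
    intro V _ _ _ ρ h
    by_cases hirr : ρ.IsIrreducible
    · apply Submodule.subset_span
      refine ⟨FDRep.of ρ, ?_, rfl⟩
      rw [FDRep.simple_iff_char_is_norm_one]
      have := invertibleOfNonzero (NeZero.ne (Nat.card G : ℂ))
      have h1 := Representation.char_orthonormal ρ ρ
      rw [if_pos ⟨Representation.Equiv.refl ρ⟩] at h1
      have h2 := (inv_mul_eq_one₀ (NeZero.ne (Nat.card G : ℂ))).1 h1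
      exact h2.symm
    · by_cases hnt : Nontrivial V
      swap
      · have : Subsingleton V := not_nontrivial_iff_subsingleton.1 hnt
        exact ih ρ (by rw [Module.finrank_zero_of_subsingleton]; omega)
      have hex : ∃ U : Subrepresentation ρ, U ≠ ⊥ ∧ U ≠ ⊤ := by
        by_contra hcon
        push Not at hcon
        apply hirr
        have hnt' : Nontrivial (Subrepresentation ρ) := by
          refine ⟨⊥, ⊤, fun hbt => ?_⟩
          have : (⊥ : Submodule ℂ V) = ⊤ := congrArg Subrepresentation.toSubmodule hbt
          exact bot_ne_top this
        exact { eq_bot_or_eq_top := fun U => or_iff_not_imp_left.2 (hcon U) }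
      obtain ⟨U, hU1, hU2⟩ := hex
      obtain ⟨U', hU'⟩ := exists_isCompl U
      have hcompl : IsCompl U.toSubmodule U'.toSubmodule := by
        constructor
        · rw [disjoint_iff, ← Subrepresentation.toSubmodule_inf, disjoint_iff.1 hU'.1]; rfl
        · rw [codisjoint_iff, ← Subrepresentation.toSubmodule_sup, codisjoint_iff.1 hU'.2]; rfl
      have hintl := (DirectSum.isInternal_submodule_iff_isCompl
        (fun b : Bool => if b then U.toSubmodule else U'.toSubmodule) (i := true) (j := false)
        (by simp) (by ext b; cases b <;> simp)).2 (by simpa using hcompl)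
      have hsum := Submodule.finrank_add_eq_of_isCompl hcompl
      have hp1 : 0 < finrank ℂ U.toSubmodule := by
        rw [Module.finrank_pos_iff, Submodule.nontrivial_iff_ne_bot]
        exact fun h => hU1 (Subrepresentation.toSubmodule_injective h)
      have hp2 : 0 < finrank ℂ U'.toSubmodule := by
        rw [Module.finrank_pos_iff, Submodule.nontrivial_iff_ne_bot]
        intro h
        rw [h] at hcompl
        exact hU2 (Subrepresentation.toSubmodule_injective (eq_top_of_isCompl_bot hcompl))
      have hch : ρ.character = U.toRepresentation.character + U'.toRepresentation.character := by
        funext g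
        have := LinearMap.trace_eq_sum_trace_restrict hintl (f := ρ g) (by
          intro b
          cases b
          · exact U'.apply_mem_toSubmodule g
          · exact U.apply_mem_toSubmodule g)
        rw [Fintype.sum_bool] at this
        exact this
      rw [hch]
      exact add_mem (ih _ (by omega)) (ih _ (by omega))

/-- Permutation characters. -/
lemma perm_char_mem {X : Type} [Fintype X] [DecidableEq X] [MulAction G X] :
    (fun g : G => ((Finset.univ.filter fun x : X => g • x = x).card : ℂ)) ∈
      Submodule.span ℤ (IrrChar G) := by
  let ρ : Representation ℂ G (X →₀ ℂ) :=
    { toFun := fun g => Finsupp.lmapDomain ℂ ℂ (fun x : X => g • x)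
      map_one' := by ext x y; simp
      map_mul' := by intro g h; ext x y; simp [mul_smul] }
  have hρ : ∀ g x, ρ g (Finsupp.single x 1) = Finsupp.single (g • x) 1 := by
    intro g x; simp [ρ]
  have h := char_mem_span (G := G) _ ρ le_rfl
  convert h using 1
  funext g
  rw [Representation.character, LinearMap.trace_eq_matrix_trace ℂ (Finsupp.basisSingleOne),
    Matrix.trace, Finset.card_filter, Nat.cast_sum]
  refine Finset.sum_congr rfl fun x _ => ?_
  simp [LinearMap.toMatrix_apply, hρ, Finsupp.single_apply]

end RepTheory

section PartTwo
open Matrix Finset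

section ChiIrr

/-- permutations act on colourings with given content -/
@[reducible] noncomputable def colorAction {k n : ℕ} (m : Fin k →₀ ℕ) :
    MulAction (Equiv.Perm (Fin n)) {f : Fin n → Fin k // cnt f = m} where
  smul g f := ⟨f.1 ∘ (g⁻¹ : Equiv.Perm (Fin n)), by
    exact (Equiv.sum_comp (g⁻¹ : Equiv.Perm (Fin n)) (fun a => Finsupp.single (f.1 a) 1)).trans f.2⟩
  one_smul f := by
    apply Subtype.ext
    change f.1 ∘ ((1 : Equiv.Perm (Fin n))⁻¹ : Equiv.Perm (Fin n)) = f.1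
    simp
  mul_smul g h f := by
    apply Subtype.ext
    change f.1 ∘ ((g * h)⁻¹ : Equiv.Perm (Fin n)) =
      (f.1 ∘ (h⁻¹ : Equiv.Perm (Fin n))) ∘ (g⁻¹ : Equiv.Perm (Fin n))
    rw [_root_.mul_inv_rev]; rfl

lemma color_char_mem {k n : ℕ} (m : Fin k →₀ ℕ) :
    (fun g : Equiv.Perm (Fin n) =>
      ((univ.filter fun f : Fin n → Fin k => f ∘ g = f ∧ cnt f = m).card : ℂ)) ∈
      Submodule.span ℤ (IrrChar (Equiv.Perm (Fin n))) := by
  classical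
  let _ := colorAction (n := n) m
  have h := perm_char_mem (G := Equiv.Perm (Fin n)) (X := {f : Fin n → Fin k // cnt f = m})
  convert h using 2 with g
  congr 1
  refine (card_bij (fun x _ => x.1) ?_ ?_ ?_).symm
  · intro x hx
    rw [mem_filter] at hx ⊢
    refine ⟨mem_univ _, ?_, x.2⟩
    have h1 : x.1 ∘ (g⁻¹ : Equiv.Perm (Fin n)) = x.1 := congrArg Subtype.val hx.2
    funext a
    have := congrFun h1 (g a)
    simpa using this.symm
  · intro x _ y _ hxy; exact Subtype.ext hxy
  · intro f hf
    rw [mem_filter] at hf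
    refine ⟨⟨f, hf.2.2⟩, ?_, rfl⟩
    rw [mem_filter]
    refine ⟨mem_univ _, Subtype.ext ?_⟩
    change f ∘ (g⁻¹ : Equiv.Perm (Fin n)) = f
    funext a
    have := congrFun hf.2.1 (g⁻¹ a)
    simpa using this.symm

lemma chi_inv {k n : ℕ} (a : Fin k →₀ ℕ) (g : Equiv.Perm (Fin n)) : chi a g⁻¹ = chi a g := by
  unfold chi; rw [PP_inv]

lemma chi_mem {k n : ℕ} (a : Fin k →₀ ℕ) :
    (fun g : Equiv.Perm (Fin n) => (chi a g : ℂ)) ∈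
      Submodule.span ℤ (IrrChar (Equiv.Perm (Fin n))) := by
  classical
  have h : (fun g : Equiv.Perm (Fin n) => (chi a g : ℂ)) =
      ∑ σ : Equiv.Perm (Fin k), (((Equiv.Perm.sign σ : ℤˣ) : ℤ) * (if ev σ ≤ a then 1 else 0)) •
      (fun g : Equiv.Perm (Fin n) =>
      ((univ.filter fun f : Fin n → Fin k => f ∘ g = f ∧ cnt f = a - ev σ).card : ℂ)) := by
    funext g
    rw [chi_expand, Finset.sum_apply]
    push_cast
    refine sum_congr rfl fun σ _ => ?_
    split_ifs <;> simp
  rw [h]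
  exact sum_mem fun σ _ => Submodule.smul_mem _ _ (color_char_mem _)

theorem chi_irr {k n : ℕ} (a : Fin k →₀ ℕ) (ha : StrictMono a) (hn : ∑ i, a i = n + ee k) :
    (fun g : Equiv.Perm (Fin n) => (chi a g : ℂ)) ∈ IrrChar (Equiv.Perm (Fin n)) := by
  have hpos := chi_one_pos a ha hn
  refine virtual_irr (chi_mem a) ?_ (chi a (1 : Equiv.Perm (Fin n))).toNat (by omega) ?_
  · simp only [chi_inv]
    have := chi_orth a a ha ha hn hn
    rw [if_pos rfl] at this
    rw [Nat.card_eq_fintype_card, Fintype.card_perm, Fintype.card_fin]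
    exact_mod_cast this
  · have : (((chi a (1 : Equiv.Perm (Fin n))).toNat : ℤ) : ℂ) = (chi a (1 : Equiv.Perm (Fin n)) : ℂ) := by
      rw [Int.toNat_of_nonneg hpos.le]
    rw [← this]; push_cast; rfl

lemma chi_injective {k n : ℕ} (a b : Fin k →₀ ℕ) (ha : StrictMono a) (hb : StrictMono b)
    (hn : ∑ i, a i = n + ee k) (hn' : ∑ i, b i = n + ee k)
    (h : ∀ g : Equiv.Perm (Fin n), chi a g = chi b g) : a = b := by
  by_contra hne
  have h1 := chi_orth a b ha hb hn hn'
  have h2 := chi_orth b b hb hb hn' hn'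
  simp only [h] at h1
  rw [if_neg hne] at h1
  rw [if_pos rfl, h1] at h2
  have := Nat.factorial_pos n
  omega

/-- Combinatorial criterion. -/
theorem maxMult_of_beta {k n : ℕ} {ι : Type} [Fintype ι] (a : ι → (Fin k →₀ ℕ))
    (hinj : Function.Injective a) (ha : ∀ j, StrictMono (a j)) (hn : ∀ j, ∑ i, a j i = n + ee k)
    (hdeg : ∀ j j', (vandermonde (fun i => (a j i : ℤ))).det * ∏ i, ((a j' i).factorial : ℤ) =
      (vandermonde (fun i => (a j' i : ℤ))).det * ∏ i, ((a j i).factorial : ℤ)) :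
    Fintype.card ι ≤ maxMult (Equiv.Perm (Fin n)) := by
  rcases isEmpty_or_nonempty ι with hι | ⟨⟨j₀⟩⟩
  · simp
  have hd : ∀ j, chi (a j) (1 : Equiv.Perm (Fin n)) = chi (a j₀) (1 : Equiv.Perm (Fin n)) := by
    intro j
    have h1 := chi_one (a j) (hn j)
    have h2 := chi_one (a j₀) (hn j₀)
    have h3 : ∀ j, (∏ i, ((a j i).factorial : ℤ)) ≠ 0 := fun j =>
      prod_ne_zero_iff.2 fun i _ => by exact_mod_cast Nat.factorial_ne_zero _
    apply mul_right_cancel₀ (mul_ne_zero (h3 j) (h3 j₀))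
    rw [← mul_assoc, h1, mul_comm (∏ i, ((a j i).factorial : ℤ)), ← mul_assoc, h2, mul_assoc, hdeg j j₀,
      mul_assoc]
  refine le_maxMult (fun j g => (chi (a j) g : ℂ)) ?_ (fun j => chi_irr _ (ha j) (hn j))
    (chi (a j₀) (1 : Equiv.Perm (Fin n))).toNat ?_
  · intro j j' h
    refine hinj (chi_injective _ _ (ha j) (ha j') (hn j) (hn j') fun g => ?_)
    have := congrFun h g
    beta_reduce at this
    exact_mod_cast this
  · intro j
    have hpos := chi_one_pos (a j₀) (ha j₀) (hn j₀)
    rw [hd]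
    have : (((chi (a j₀) (1 : Equiv.Perm (Fin n))).toNat : ℤ) : ℂ) =
        (chi (a j₀) (1 : Equiv.Perm (Fin n)) : ℂ) := by
      rw [Int.toNat_of_nonneg hpos.le]
    rw [← this]; push_cast; rfl

end ChiIrr

section Comb
open LaurentPolynomial

/-- characteristic Laurent polynomial of a finite set (difference form) -/
noncomputable def bb (X : Finset ℕ) : LaurentPolynomial ℤ :=
  1 + (T 1 - 1) * ∑ x ∈ X, T (x : ℤ)

lemma geom_T (p q : ℕ) (h : p ≤ q) :
    (T 1 - 1 : LaurentPolynomial ℤ) * ∑ x ∈ Ico p q, T (x : ℤ) = T (q : ℤ) - T (p : ℤ) := by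
  induction q, h using Nat.le_induction with
  | base => simp
  | succ q h ih =>
    rw [sum_Ico_succ_top h, mul_add, ih, sub_mul, one_mul, ← T_add]
    push_cast
    rw [add_comm (1 : ℤ)]; ring

/-- translate of a set -/
def sh (X : Finset ℕ) (c : ℕ) : Finset ℕ := X.map (addRightEmbedding c)

lemma mem_sh {X : Finset ℕ} {c x : ℕ} : x ∈ sh X c ↔ ∃ y ∈ X, y + c = x := by
  simp [sh]

lemma sum_T_sh (X : Finset ℕ) (c : ℕ) :
    ∑ x ∈ sh X c, (T (x : ℤ) : LaurentPolynomial ℤ) = T (c : ℤ) * ∑ x ∈ X, T (x : ℤ) := by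
  rw [sh, sum_map, mul_sum]
  refine sum_congr rfl fun x _ => ?_
  rw [← T_add]; simp [add_comm]

lemma sum_sh (X : Finset ℕ) (c : ℕ) : ∑ x ∈ sh X c, x = ∑ x ∈ X, x + X.card * c := by
  rw [sh, sum_map]
  simp [sum_add_distrib]

lemma card_sh (X : Finset ℕ) (c : ℕ) : (sh X c).card = X.card := by simp [sh]

lemma gs_add (a b : ℕ) : ∑ j ∈ range (a + b), j = ∑ j ∈ range a, j + a * b + ∑ j ∈ range b, j := by
  induction b with
  | zero => simp
  | succ b ih => rw [← add_assoc, sum_range_succ, ih, sum_range_succ]; ring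

lemma sum_Ico_id (p d : ℕ) : ∑ j ∈ Ico p (p + d), j = d * p + ∑ j ∈ range d, j := by
  rw [sum_Ico_eq_sum_range, sum_add_distrib]; simp

/-- `X` is a beta set in `[0,D)` of cardinality `k` for a partition of `n`. -/
structure IsB (X : Finset ℕ) (D k n : ℕ) : Prop where
  lt : ∀ x ∈ X, x < D
  card : X.card = k
  sum : ∑ x ∈ X, x = n + ∑ j ∈ range k, j

/-- shifted set -/
def shiftB (X : Finset ℕ) (c : ℕ) : Finset ℕ := range c ∪ sh X c

lemma shiftB_disj (X : Finset ℕ) (c : ℕ) : Disjoint (range c) (sh X c) := by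
  rw [disjoint_left]
  intro x hx hx'
  obtain ⟨y, _, rfl⟩ := mem_sh.1 hx'
  rw [mem_range] at hx; omega

lemma shiftB_isB {X : Finset ℕ} {D k n : ℕ} (h : IsB X D k n) (c : ℕ) :
    IsB (shiftB X c) (c + D) (c + k) n := by
  refine ⟨?_, ?_, ?_⟩
  · intro x hx
    rcases mem_union.1 hx with hx | hx
    · rw [mem_range] at hx; omega
    · obtain ⟨y, hy, rfl⟩ := mem_sh.1 hx
      have := h.lt y hy; omega
  · rw [shiftB, card_union_of_disjoint (shiftB_disj X c), card_sh, card_range, h.card]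
  · rw [shiftB, sum_union (shiftB_disj X c), sum_sh, h.sum, h.card, gs_add]; ring

lemma shiftB_bb (X : Finset ℕ) (c : ℕ) : bb (shiftB X c) = T (c : ℤ) * bb X := by
  rw [bb, shiftB, sum_union (shiftB_disj X c), sum_T_sh, mul_add, range_eq_Ico, geom_T _ _ (Nat.zero_le c), bb]
  simp; ring

/-- one incremental step -/
def stepB (Y X : Finset ℕ) (p d : ℕ) : Finset ℕ := Y ∪ ((Ico p (p + d) \ sh X p) ∪ sh X (p + d))

lemma step_disj {Y X : Finset ℕ} {E D p d : ℕ} (hY : ∀ y ∈ Y, y < E) (hX : ∀ x ∈ X, x < D)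
    (hp : E ≤ p) (hd : D ≤ d) :
    Disjoint Y ((Ico p (p + d) \ sh X p) ∪ sh X (p + d)) ∧
    Disjoint (Ico p (p + d) \ sh X p) (sh X (p + d)) ∧ sh X p ⊆ Ico p (p + d) := by
  refine ⟨?_, ?_, ?_⟩
  · rw [disjoint_left]
    intro x hx hx'
    have := hY x hx
    rcases mem_union.1 hx' with hx' | hx'
    · rw [mem_sdiff, mem_Ico] at hx'; omega
    · obtain ⟨y, _, rfl⟩ := mem_sh.1 hx'
      omega
  · rw [disjoint_left]
    intro x hx hx'
    obtain ⟨y, _, rfl⟩ := mem_sh.1 hx'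
    rw [mem_sdiff, mem_Ico] at hx; omega
  · intro x hx
    obtain ⟨y, hy, rfl⟩ := mem_sh.1 hx
    have := hX y hy
    rw [mem_Ico]; omega

lemma stepB_isB {Y X : Finset ℕ} {E D p d k k' n n' m : ℕ} (hY : IsB Y E k' n') (hX : IsB X D k n)
    (hp : E ≤ p) (hd : D ≤ d) (hm : m + d * k' = n' + d * (p + k)) :
    IsB (stepB Y X p d) (p + d + D) (k' + d) m := by
  obtain ⟨h1, h2, h3⟩ := step_disj hY.lt hX.lt hp hd
  refine ⟨?_, ?_, ?_⟩
  · intro x hx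
    rcases mem_union.1 hx with hx | hx
    · have := hY.lt x hx; omega
    · rcases mem_union.1 hx with hx | hx
      · rw [mem_sdiff, mem_Ico] at hx; omega
      · obtain ⟨y, hy, rfl⟩ := mem_sh.1 hx
        have := hX.lt y hy; omega
  · rw [stepB, card_union_of_disjoint h1, card_union_of_disjoint h2, card_sdiff_of_subset h3, card_sh,
      card_sh, Nat.card_Ico, hY.card]
    have := card_le_card h3
    rw [card_sh, Nat.card_Ico] at this
    omega
  · rw [stepB, sum_union h1, sum_union h2]
    have h4 := sum_sdiff h3 (f := fun x => x)
    rw [sum_Ico_id, sum_sh] at h4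
    rw [sum_sh, hY.sum, gs_add, hX.card]
    rw [hX.card] at h4
    nlinarith

lemma stepB_bb {Y X : Finset ℕ} {E D p d : ℕ} (hY : ∀ y ∈ Y, y < E) (hX : ∀ x ∈ X, x < D)
    (hp : E ≤ p) (hd : D ≤ d) :
    bb (stepB Y X p d) = bb Y + (T ((p + d : ℕ) : ℤ) - T (p : ℤ)) * bb X := by
  obtain ⟨h1, h2, h3⟩ := step_disj hY hX hp hd
  have h4 := sum_sdiff h3 (f := fun x : ℕ => (T (x : ℤ) : LaurentPolynomial ℤ))
  have h5 := geom_T p (p + d) (by omega)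
  rw [← h4, sum_T_sh] at h5
  rw [bb, stepB, sum_union h1, sum_union h2, sum_T_sh, bb, bb]
  linear_combination h5

lemma stepB_low {Y X : Finset ℕ} {E p d : ℕ} (hY : ∀ y ∈ Y, y < E) (hp : E ≤ p) :
    (stepB Y X p d).filter (fun x => x < E) = Y := by
  ext x
  simp only [mem_filter, stepB, mem_union, mem_sdiff, mem_Ico, mem_sh]
  constructor
  · rintro ⟨h | h | ⟨y, _, rfl⟩, hx⟩
    · exact h
    · omega
    · omega
  · intro h; exact ⟨Or.inl h, hY x h⟩

lemma shiftB_inj {X X' : Finset ℕ} {c : ℕ} (h : shiftB X c = shiftB X' c) : X = X' := by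
  have key : ∀ Z : Finset ℕ, ∀ x, x ∈ Z ↔ x + c ∈ shiftB Z c := by
    intro Z x
    simp [shiftB, mem_sh]
  ext x
  rw [key X, key X', h]

/-- the autocorrelation -/
noncomputable def cc (X : Finset ℕ) : LaurentPolynomial ℤ := bb X * invert (bb X)

theorem family (j : ℕ) : ∃ (F : Finset (Finset ℕ)) (k n : ℕ) (β : LaurentPolynomial ℤ),
    F.card = 2 ^ j ∧ n ≤ 25 ^ j ∧ ∀ X ∈ F, IsB X (5 ^ j) k n ∧ cc X = β := by
  induction j with
  | zero =>
    refine ⟨{∅}, 0, 0, cc ∅, by simp, by simp, ?_⟩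
    intro X hX
    rw [mem_singleton] at hX
    subst hX
    exact ⟨⟨by simp, by simp, by simp⟩, rfl⟩
  | succ j ih =>
    obtain ⟨F, k, n, β, hF, hn, hX⟩ := ih
    set M := 5 ^ j with hM
    have hM0 : 0 < M := by positivity
    let pl : Finset ℕ → Finset ℕ := fun X => stepB X X M (2 * M)
    let mi : Finset ℕ → Finset ℕ := fun X => stepB (shiftB X M) X (3 * M) M
    let u : LaurentPolynomial ℤ := T (M : ℤ)
    let v : LaurentPolynomial ℤ := T (-(M : ℤ))
    have huv : u * v = 1 := by simp only [u, v]; rw [← T_add]; simp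
    have hu3 : (T ((3 * M : ℕ) : ℤ) : LaurentPolynomial ℤ) = u ^ 3 := by
      simp only [u]; rw [T_pow]; push_cast; ring_nf
    have hu4 : (T ((4 * M : ℕ) : ℤ) : LaurentPolynomial ℤ) = u ^ 4 := by
      simp only [u]; rw [T_pow]; push_cast; ring_nf
    have hinv : invert u = v := by simp [u, v]
    have hpl : ∀ X ∈ F, bb (pl X) = (1 - u + u ^ 3) * bb X := by
      intro X h
      have := (hX X h).1.lt
      simp only [pl]
      rw [stepB_bb this this le_rfl (by omega), show M + 2 * M = 3 * M by ring, hu3]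
      simp only [u]; ring
    have hmi : ∀ X ∈ F, bb (mi X) = (u - u ^ 3 + u ^ 4) * bb X := by
      intro X h
      have := (hX X h).1.lt
      simp only [mi]
      rw [stepB_bb (shiftB_isB (hX X h).1 M).lt this (by omega) le_rfl, shiftB_bb,
        show 3 * M + M = 4 * M by ring, hu3, hu4]
      simp only [u]; ring
    have hdis : Disjoint (F.image pl) (F.image mi) := by
      rw [disjoint_left]
      intro Z h1 h2
      obtain ⟨X, hXF, rfl⟩ := mem_image.1 h1
      obtain ⟨X', hXF', h3⟩ := mem_image.1 h2
      have h4 : 2 * M ∈ pl X := by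
        simp only [pl, stepB, mem_union, mem_sdiff, mem_Ico, mem_sh]
        right; left
        refine ⟨by omega, ?_⟩
        rintro ⟨y, hy, hy'⟩
        have := (hX X hXF).1.lt y hy
        omega
      rw [← h3] at h4
      simp only [mi, stepB, mem_union, mem_sdiff, mem_Ico, mem_sh] at h4
      rcases h4 with h4 | h4 | ⟨y, _, hy⟩
      · have := (shiftB_isB (hX X' hXF').1 M).lt _ h4
        omega
      · omega
      · omega
    refine ⟨F.image pl ∪ F.image mi, k + 2 * M, n + 2 * M ^ 2,
      (1 - u + u ^ 3) * (1 - v + v ^ 3) * β, ?_, ?_, ?_⟩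
    · rw [card_union_of_disjoint hdis, card_image_of_injOn, card_image_of_injOn, hF, pow_succ]
      · ring
      · intro X h X' h' he
        have e1 := stepB_low (X := X) (p := 3 * M) (d := M) (shiftB_isB (hX X h).1 M).lt (by omega)
        have e2 := stepB_low (X := X') (p := 3 * M) (d := M) (shiftB_isB (hX X' h').1 M).lt (by omega)
        simp only [mi] at he
        rw [he, e2] at e1
        exact (shiftB_inj e1).symm
      · intro X h X' h' he
        have e1 := stepB_low (X := X) (p := M) (d := 2 * M) (hX X h).1.lt le_rfl
        have e2 := stepB_low (X := X') (p := M) (d := 2 * M) (hX X' h').1.lt le_rfl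
        simp only [pl] at he
        rw [he, e2] at e1
        exact e1.symm
    · have : M ^ 2 = 25 ^ j := by rw [hM, ← pow_mul, mul_comm, pow_mul]; norm_num
      rw [this, pow_succ]; omega
    · intro Z hZ
      rcases mem_union.1 hZ with h | h
      · obtain ⟨X, hXF, rfl⟩ := mem_image.1 h
        clear h
        have h := hXF
        obtain ⟨hB, hc⟩ := hX X h
        refine ⟨?_, ?_⟩
        · have := stepB_isB (m := n + 2 * M ^ 2) (p := M) (d := 2 * M) hB hB le_rfl (by omega) (by ring)
          refine ⟨fun x hx => ?_, this.card, this.sum⟩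
          have h5 := this.lt x hx
          rw [pow_succ, ← hM]; omega
        · rw [cc, hpl X h, ← hc, cc]
          simp only [map_mul, map_add, map_sub, map_pow, map_one, hinv]
          ring
      · obtain ⟨X, hXF, rfl⟩ := mem_image.1 h
        clear h
        have h := hXF
        obtain ⟨hB, hc⟩ := hX X h
        refine ⟨?_, ?_⟩
        · have := stepB_isB (m := n + 2 * M ^ 2) (p := 3 * M) (d := M) (shiftB_isB hB M) hB (by omega)
            le_rfl (by ring)
          rw [show 3 * M + M + M = 5 ^ (j + 1) by rw [pow_succ, ← hM]; ring,
            show M + k + M = k + 2 * M by ring] at this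
          exact this
        · rw [cc, hmi X h, ← hc, cc]
          simp only [map_mul, map_add, map_sub, map_pow, map_one, hinv]
          have e1 : u - u ^ 3 + u ^ 4 = u ^ 4 * (1 - v + v ^ 3) := by
            linear_combination (-u * (u ^ 2 * v ^ 2 + u * v + 1) + u ^ 3) * huv
          have e2 : v - v ^ 3 + v ^ 4 = v ^ 4 * (1 - u + u ^ 3) := by
            linear_combination (-v * (u ^ 2 * v ^ 2 + u * v + 1) + v ^ 3) * huv
          have e3 : u ^ 4 * v ^ 4 = 1 := by rw [← mul_pow, huv, one_pow]
          rw [e1, e2]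
          linear_combination ((1 - v + v ^ 3) * (1 - u + u ^ 3) * bb X * invert (bb X)) * e3

theorem family_final (j n : ℕ) (hn : 8 * 25 ^ j + 3 * 5 ^ j ≤ n) :
    ∃ (F : Finset (Finset ℕ)) (k D : ℕ) (β : LaurentPolynomial ℤ),
    F.card = 2 ^ j ∧ ∀ X ∈ F, IsB X D k n ∧ cc X = β := by
  obtain ⟨F, k, n₀, β, hF, hn0, hX⟩ := family j
  set g := 5 ^ j with hg
  have hg0 : 0 < g := by positivity
  have hgg : g ^ 2 = 25 ^ j := by rw [hg, ← pow_mul, mul_comm, pow_mul]; norm_num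
  obtain ⟨N, hN⟩ : ∃ N, n = n₀ + N := ⟨n - n₀, by omega⟩
  have hex : ∃ d1 d2, g ≤ d1 ∧ g ≤ d2 ∧ N = d1 * g + d2 * (2 * g + 1) := by
    set r := N % g with hr
    have hrg : r < g := Nat.mod_lt _ hg0
    have hdiv : g * (N / g) + r = N := Nat.div_add_mod N g
    set t := N / g
    have ht : 5 * g + 2 + 2 * r ≤ t := by
      by_contra hcon
      have h1 : t + 1 ≤ 5 * g + 2 + 2 * r := by omega
      have h2 : 7 * g ^ 2 + 3 * g ≤ N := by omega
      nlinarith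
    refine ⟨t - (2 * g + 1 + 2 * r), g + r, by omega, by omega, ?_⟩
    obtain ⟨s, hs⟩ : ∃ s, t = s + (2 * g + 1 + 2 * r) := ⟨t - (2 * g + 1 + 2 * r), by omega⟩
    rw [← hdiv, hs, Nat.add_sub_cancel]; ring
  obtain ⟨d1, d2, h1, h2, hN2⟩ := hex
  let f : Finset ℕ → Finset ℕ := fun X => stepB (stepB X X g d1) X (2 * g + d1 + 1) d2
  let P : LaurentPolynomial ℤ := 1 + (T ((g + d1 : ℕ) : ℤ) - T (g : ℤ)) +
    (T ((2 * g + d1 + 1 + d2 : ℕ) : ℤ) - T ((2 * g + d1 + 1 : ℕ) : ℤ))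
  have hB1 : ∀ X ∈ F, IsB (stepB X X g d1) (g + d1 + g) (k + d1) (n₀ + d1 * g) := fun X h =>
    stepB_isB (hX X h).1 (hX X h).1 le_rfl h1 (by ring)
  refine ⟨F.image f, k + d1 + d2, 2 * g + d1 + 1 + d2 + g, P * invert P * β, ?_, ?_⟩
  · rw [card_image_of_injOn, hF]
    intro X h X' h' he
    have e1 := stepB_low (X := X) (p := 2 * g + d1 + 1) (d := d2) (hB1 X h).lt (by omega)
    have e2 := stepB_low (X := X') (p := 2 * g + d1 + 1) (d := d2) (hB1 X' h').lt (by omega)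
    simp only [f] at he
    rw [he, e2] at e1
    have e3 := stepB_low (X := X) (p := g) (d := d1) (hX X h).1.lt le_rfl
    have e4 := stepB_low (X := X') (p := g) (d := d1) (hX X' h').1.lt le_rfl
    rw [← e1, e4] at e3
    exact e3.symm
  · intro Z hZ
    obtain ⟨X, h, rfl⟩ := mem_image.1 hZ
    obtain ⟨hB, hc⟩ := hX X h
    refine ⟨?_, ?_⟩
    · exact stepB_isB (hB1 X h) hB (by omega) h2 (by rw [hN, hN2]; ring)
    · have : bb (f X) = P * bb X := by
        simp only [f]
        rw [stepB_bb (hB1 X h).lt hB.lt (by omega) h2, stepB_bb hB.lt hB.lt le_rfl h1]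
        simp only [P]; ring
      rw [cc, this, ← hc, cc, map_mul]; ring

end Comb

section Hook
open LaurentPolynomial

/-- iterated sums of logarithms of factorials -/
noncomputable def LL (h : ℤ) : ℝ := ∑ j ∈ range h.natAbs, Real.log (j.factorial : ℝ)

lemma LL_neg (h : ℤ) : LL (-h) = LL h := by simp [LL]

lemma LL_nat (m : ℕ) : LL (m : ℤ) = ∑ j ∈ range m, Real.log (j.factorial : ℝ) := by simp [LL]

lemma LL_succ (m : ℕ) : LL ((m : ℤ) + 1) = LL m + Real.log (m.factorial : ℝ) := by
  have : ((m : ℤ) + 1) = ((m + 1 : ℕ) : ℤ) := by push_cast; ring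
  rw [this, LL_nat, LL_nat, sum_range_succ]

lemma LL_diff_nat (m : ℕ) : LL ((m : ℤ) + 1) + LL ((m : ℤ) - 1) - 2 * LL m = Real.log (m : ℝ) := by
  cases m with
  | zero => simp [LL]
  | succ m =>
    have h1 : (((m + 1 : ℕ) : ℤ) - 1) = (m : ℤ) := by push_cast; ring
    rw [h1, LL_succ, Nat.factorial_succ]
    push_cast
    rw [Real.log_mul (by positivity) (by positivity), LL_succ]; ring

lemma LL_diff (h : ℤ) : LL (h + 1) + LL (h - 1) - 2 * LL h = Real.log (h : ℝ) := by
  obtain ⟨m, rfl | rfl⟩ := h.eq_nat_or_neg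
  · exact_mod_cast LL_diff_nat m
  · have := LL_diff_nat m
    rw [← LL_neg ((m : ℤ) + 1), ← LL_neg ((m : ℤ) - 1), ← LL_neg (m : ℤ)] at this
    push_cast
    rw [Real.log_neg_eq_log, ← this]
    ring_nf

/-- the functional -/
noncomputable def Phi : LaurentPolynomial ℤ →+ ℝ :=
  (Finsupp.liftAddHom (fun h : ℤ => zmultiplesHom ℝ (LL h))).comp
    AddMonoidAlgebra.coeffAddEquiv.toAddMonoidHom

lemma Phi_T (h : ℤ) : Phi (T h) = LL h := by
  have : Phi (T h) = Finsupp.liftAddHom (fun h : ℤ => zmultiplesHom ℝ (LL h)) (Finsupp.single h 1) := rfl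
  rw [this, Finsupp.liftAddHom_apply_single]; simp

lemma cc_expand (X : Finset ℕ) : cc X = T 0 + ∑ x ∈ X, (T ((x : ℤ) + 1) - T (x : ℤ)) +
    ∑ x ∈ X, (T (-((x : ℤ) + 1)) - T (-(x : ℤ))) -
    ∑ x ∈ X, ∑ y ∈ X, (T ((x : ℤ) - y + 1) + T ((x : ℤ) - y - 1) - (T ((x : ℤ) - y) + T ((x : ℤ) - y))) := by
  have e1 : ∑ x ∈ X, (T ((x : ℤ) + 1) - T (x : ℤ) : LaurentPolynomial ℤ) = (T 1 - 1) * ∑ x ∈ X, T (x : ℤ) := by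
    rw [mul_sum]
    exact sum_congr rfl fun x _ => by rw [sub_mul, ← T_add, one_mul, add_comm]
  have e2 : ∑ x ∈ X, (T (-((x : ℤ) + 1)) - T (-(x : ℤ)) : LaurentPolynomial ℤ) =
      (T (-1) - 1) * ∑ x ∈ X, T (-(x : ℤ)) := by
    rw [mul_sum]
    exact sum_congr rfl fun x _ => by rw [sub_mul, ← T_add, one_mul]; ring_nf
  have e3 : ∑ x ∈ X, ∑ y ∈ X, (T ((x : ℤ) - y + 1) + T ((x : ℤ) - y - 1) -
      (T ((x : ℤ) - y) + T ((x : ℤ) - y)) : LaurentPolynomial ℤ) =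
      (T 1 + T (-1) - 2) * ((∑ x ∈ X, T (x : ℤ)) * ∑ y ∈ X, T (-(y : ℤ))) := by
    rw [sum_mul_sum, mul_sum]
    refine sum_congr rfl fun x _ => ?_
    rw [mul_sum]
    refine sum_congr rfl fun y _ => ?_
    rw [← T_add, sub_mul, add_mul, ← T_add, ← T_add, two_mul]
    ring_nf
  have e4 : (T 1 * T (-1) : LaurentPolynomial ℤ) = 1 := by rw [← T_add]; simp
  rw [e1, e2, e3, cc, bb]
  simp only [map_add, map_mul, map_sub, map_one, map_sum, invert_T, T_zero]
  linear_combination ((∑ x ∈ X, T (x : ℤ)) * ∑ y ∈ X, T (-(y : ℤ)) : LaurentPolynomial ℤ) * e4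

lemma Phi_cc (X : Finset ℕ) : Phi (cc X) = 2 * ∑ x ∈ X, Real.log (x.factorial : ℝ) -
    ∑ x ∈ X, ∑ y ∈ X, Real.log ((x : ℝ) - y) := by
  rw [cc_expand]
  simp only [map_add, map_sub, map_sum, Phi_T, LL_neg]
  have h0 : LL 0 = 0 := by simp [LL]
  have h1 : ∀ x : ℕ, LL ((x : ℤ) + 1) - LL x = Real.log (x.factorial : ℝ) := by
    intro x; rw [LL_succ]; ring
  have h2 : ∀ x y : ℕ, LL ((x : ℤ) - y + 1) + LL ((x : ℤ) - y - 1) - (LL ((x : ℤ) - y) + LL ((x : ℤ) - y))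
      = Real.log ((x : ℝ) - y) := by
    intro x y
    have := LL_diff ((x : ℤ) - y)
    push_cast at this
    rw [← this]; ring
  simp only [h0, h1, h2]; ring

lemma log_vand {k : ℕ} (a : Fin k → ℕ) (ha : StrictMono a) :
    2 * Real.log ((vandermonde (fun i => (a i : ℤ))).det : ℝ) =
      ∑ i, ∑ j, Real.log ((a i : ℝ) - a j) := by
  rw [det_vandermonde]
  push_cast
  have hne : ∀ i, ∀ j ∈ Ioi i, ((a j : ℝ) - a i) ≠ 0 := by
    intro i j hj
    have := ha (mem_Ioi.1 hj)
    have : (a i : ℝ) < a j := by exact_mod_cast this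
    linarith
  rw [Real.log_prod (fun i _ => prod_ne_zero_iff.2 (hne i))]
  have h1 : ∑ i, Real.log (∏ j ∈ Ioi i, ((a j : ℝ) - a i)) = ∑ i, ∑ j ∈ Ioi i, Real.log ((a j : ℝ) - a i) :=
    sum_congr rfl fun i _ => Real.log_prod (hne i)
  rw [h1]
  have h2 := sum_sum_Ioi_add_eq_sum_sum_off_diag (fun i j : Fin k => Real.log ((a i : ℝ) - a j))
  have h3 : ∀ i j : Fin k, Real.log ((a i : ℝ) - a j) = Real.log ((a j : ℝ) - a i) := by
    intro i j; rw [← Real.log_neg_eq_log, neg_sub]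
  have h4 : ∑ i : Fin k, ∑ j, Real.log ((a i : ℝ) - a j) =
      ∑ i, ∑ j ∈ {i}ᶜ, Real.log ((a j : ℝ) - a i) := by
    refine sum_congr rfl fun i _ => ?_
    rw [← sum_compl_add_sum {i}]
    simp [h3 i]
  rw [h4, ← h2, mul_sum]
  refine sum_congr rfl fun i _ => ?_
  rw [mul_sum]
  refine sum_congr rfl fun j _ => ?_
  rw [h3 i j]; ring

/-- the sequence attached to a finite set -/
noncomputable def seqOf (X : Finset ℕ) (k : ℕ) (h : X.card = k) : Fin k →₀ ℕ :=
  Finsupp.equivFunOnFinite.symm (X.orderEmbOfFin h)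

lemma seqOf_mono (X : Finset ℕ) (k : ℕ) (h : X.card = k) : StrictMono (seqOf X k h) :=
  (X.orderEmbOfFin h).strictMono

lemma seqOf_image (X : Finset ℕ) (k : ℕ) (h : X.card = k) : univ.image (seqOf X k h) = X := by
  exact X.image_orderEmbOfFin_univ h

lemma seqOf_sum {M : Type*} [AddCommMonoid M] (X : Finset ℕ) (k : ℕ) (h : X.card = k) (f : ℕ → M) :
    ∑ i, f (seqOf X k h i) = ∑ x ∈ X, f x := by
  conv_rhs => rw [← seqOf_image X k h]
  rw [sum_image fun i _ j _ hij => (seqOf_mono X k h).injective hij]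

lemma deg_eq (X Y : Finset ℕ) (k : ℕ) (hX : X.card = k) (hY : Y.card = k) (h : cc X = cc Y) :
    (vandermonde (fun i => (seqOf X k hX i : ℤ))).det * ∏ i, ((seqOf Y k hY i).factorial : ℤ) =
      (vandermonde (fun i => (seqOf Y k hY i : ℤ))).det * ∏ i, ((seqOf X k hX i).factorial : ℤ) := by
  have key : ∀ (Z : Finset ℕ) (hZ : Z.card = k), Phi (cc Z) =
      2 * Real.log (∏ i, ((seqOf Z k hZ i).factorial : ℝ)) -
      2 * Real.log ((vandermonde (fun i => (seqOf Z k hZ i : ℤ))).det : ℝ) := by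
    intro Z hZ
    rw [Phi_cc, log_vand _ (seqOf_mono Z k hZ), Real.log_prod (fun i _ => by positivity),
      seqOf_sum Z k hZ (fun x => Real.log (x.factorial : ℝ))]
    congr 1
    rw [← seqOf_sum Z k hZ]
    refine sum_congr rfl fun i _ => ?_
    rw [← seqOf_sum Z k hZ]
  have hV : ∀ (Z : Finset ℕ) (hZ : Z.card = k),
      (0 : ℝ) < ((vandermonde (fun i => (seqOf Z k hZ i : ℤ))).det : ℝ) := by
    intro Z hZ
    rw [det_vandermonde]
    have : (0 : ℤ) < ∏ i, ∏ j ∈ Ioi i, ((seqOf Z k hZ j : ℤ) - seqOf Z k hZ i) := by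
      refine prod_pos fun i _ => prod_pos fun j hj => ?_
      have := seqOf_mono Z k hZ (mem_Ioi.1 hj)
      omega
    exact_mod_cast this
  have hP : ∀ (Z : Finset ℕ) (hZ : Z.card = k), (0 : ℝ) < ∏ i, ((seqOf Z k hZ i).factorial : ℝ) :=
    fun Z hZ => prod_pos fun i _ => by positivity
  have h1 := key X hX
  rw [h, key Y hY] at h1
  have h2 : Real.log (((vandermonde (fun i => (seqOf X k hX i : ℤ))).det : ℝ) *
      ∏ i, ((seqOf Y k hY i).factorial : ℝ)) =
      Real.log (((vandermonde (fun i => (seqOf Y k hY i : ℤ))).det : ℝ) *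
      ∏ i, ((seqOf X k hX i).factorial : ℝ)) := by
    rw [Real.log_mul (hV X hX).ne' (hP Y hY).ne', Real.log_mul (hV Y hY).ne' (hP X hX).ne']
    linarith
  have h3 := Real.log_injOn_pos (Set.mem_Ioi.2 (mul_pos (hV X hX) (hP Y hY)))
    (Set.mem_Ioi.2 (mul_pos (hV Y hY) (hP X hX))) h2
  exact_mod_cast h3

theorem maxMult_large (i n : ℕ) (hn : 8 * 25 ^ i + 3 * 5 ^ i ≤ n) :
    2 ^ i ≤ maxMult (Equiv.Perm (Fin n)) := by
  obtain ⟨F, k, D, β, hF, hX⟩ := family_final i n hn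
  have h := maxMult_of_beta (n := n) (ι := F) (fun X => seqOf X.1 k (hX X.1 X.2).1.card) ?_ ?_ ?_ ?_
  · rwa [Fintype.card_coe, hF] at h
  · intro X Y hXY
    beta_reduce at hXY
    apply Subtype.ext
    rw [← seqOf_image X.1 k (hX X.1 X.2).1.card, hXY, seqOf_image]
  · intro X; exact seqOf_mono _ _ _
  · intro X
    rw [seqOf_sum _ _ _ (fun x => x), (hX X.1 X.2).1.sum, ee_eq, Fin.sum_univ_eq_sum_range (fun j => j)]
  · intro X Y
    exact deg_eq _ _ _ _ _ ((hX X.1 X.2).2.trans (hX Y.1 Y.2).2.symm)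

end Hook

end PartTwo

theorem bound_aux (j : ℕ) (hj : 18 ≤ j) : (8 * 25 ^ (j+2) + 3 * 5 ^ (j+2) : ℝ) ≤ 
   (15 - 16 * 3 ^ (j+1) + 1025 * 9 ^ j + 1584 * 27 ^ j
          + 576 * 81 ^ j - 8 * ((j+2 : ℕ) : ℝ)) / 32 := by
  have h1 : (5075 * 25 ^ j : ℝ) ≤ 18 * 81 ^ j := by
    induction j, hj using Nat.le_induction with
    | base => norm_num
    | succ k hk ih =>
      rw [pow_succ, pow_succ]
      have : (0:ℝ) < 25 ^ k := by positivity
      have : (0:ℝ) < 81 ^ k := by positivity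
      nlinarith
  have h2 : (5 ^ j : ℝ) ≤ 25 ^ j := by gcongr; norm_num
  have h3 : (3 ^ j : ℝ) ≤ 9 ^ j := by gcongr; norm_num
  have h4 : (j : ℝ) + 1 ≤ 3 ^ j := by
    have : j < 3 ^ j := Nat.lt_pow_self (by norm_num)
    exact_mod_cast this
  have h5 : (0:ℝ) < 27 ^ j := by positivity
  have h6 : (0:ℝ) < 3 ^ j := by positivity
  push_cast
  rw [pow_succ (3:ℝ) j, pow_add, pow_add]
  linarith

theorem stmt7 :
    ∃ i₀ : ℕ, ∀ i : ℕ, i₀ ≤ i → ∀ n : ℕ,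
      (15 - 16 * 3 ^ (i - 1) + 1025 * 9 ^ (i - 2) + 1584 * 27 ^ (i - 2)
          + 576 * 81 ^ (i - 2) - 8 * (i : ℝ)) / 32 ≤ (n : ℝ) →
      2 ^ i ≤ maxMult (Equiv.Perm (Fin n)) := by
  refine ⟨20, fun i hi n hn => ?_⟩
  obtain ⟨j, rfl⟩ : ∃ j, i = j + 2 := ⟨i - 2, by omega⟩
  have h := bound_aux j (by omega)
  have e1 : j + 2 - 1 = j + 1 := by omega
  have e2 : j + 2 - 2 = j := by omega
  rw [e1, e2] at hn
  apply maxMult_large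
  exact_mod_cast h.trans hn
end

section
/- Let p be a prime and let G be a powerful finite p-group. Then k(G) ≥ (1 − p^{−1})·|G|^{1/d}, where k(G) is the number of conjugacy classes of G and d = d(G) is the minimal number of generators of G. -/
/-- A finite `p`-group `G` is powerful if `[G,G] ≤ Gᵖ` for `p` odd, and `[G,G] ≤ G⁴`
for `p = 2`. -/
def IsPowerful (p : ℕ) (G : Type) [Group G] : Prop :=
  if p = 2 then commutator G ≤ Subgroup.closure {x : G | ∃ g : G, x = g ^ 4}
  else commutator G ≤ Subgroup.closure {x : G | ∃ g : G, x = g ^ p}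

/-- `d(G)`: the minimal number of generators of `G`. -/
noncomputable def minGens (G : Type) [Group G] : ℕ :=
  sInf {n : ℕ | ∃ S : Finset G, S.card = n ∧ Subgroup.closure (S : Set G) = ⊤}

section Aux

open scoped commutatorElement

/-- The lower exponent-`p` central series. -/
def PS (p : ℕ) (G : Type) [Group G] : ℕ → Subgroup G
  | 0 => ⊤
  | n + 1 => Subgroup.closure {x : G | ∃ g ∈ PS p G n, x = g ^ p} ⊔ ⁅PS p G n, (⊤ : Subgroup G)⁆

variable {p : ℕ} {G : Type} [Group G]

theorem PS_pow {n : ℕ} {x : G} (hx : x ∈ PS p G n) : x ^ p ∈ PS p G (n + 1) :=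
  Subgroup.mem_sup_left (Subgroup.subset_closure ⟨x, hx, rfl⟩)

theorem PS_comm {n : ℕ} {x : G} (hx : x ∈ PS p G n) (g : G) : ⁅x, g⁆ ∈ PS p G (n + 1) :=
  Subgroup.mem_sup_right (Subgroup.commutator_mem_commutator hx (Subgroup.mem_top g))

theorem PS_succ_le_iff {n : ℕ} {H : Subgroup G} :
    PS p G (n + 1) ≤ H ↔ (∀ x ∈ PS p G n, x ^ p ∈ H) ∧ (∀ x ∈ PS p G n, ∀ g : G, ⁅x, g⁆ ∈ H) := by
  constructor
  · intro h
    exact ⟨fun x hx => h (PS_pow hx), fun x hx g => h (PS_comm hx g)⟩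
  · rintro ⟨h1, h2⟩
    refine sup_le ?_ ?_
    · rw [Subgroup.closure_le]
      rintro x ⟨g, hg, rfl⟩
      exact h1 g hg
    · rw [Subgroup.commutator_le]
      intro x hx g _
      exact h2 x hx g

theorem PS_aux (n : ℕ) : (PS p G n).Normal ∧ PS p G (n + 1) ≤ PS p G n := by
  induction n with
  | zero => exact ⟨by unfold PS; infer_instance, le_top⟩
  | succ n ih =>
    have hN : (PS p G (n + 1)).Normal := by
      refine ⟨fun h hh g => ?_⟩
      have h1 := PS_comm (ih.2 hh) g
      have : g * h * g⁻¹ = (⁅h, g⁆)⁻¹ * h := by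
        simp [commutatorElement_def, mul_assoc]
      rw [this]
      exact mul_mem (inv_mem h1) hh
    refine ⟨hN, ?_⟩
    rw [PS_succ_le_iff]
    refine ⟨fun x hx => pow_mem hx p, fun x hx g => ?_⟩
    have : ⁅x, g⁆ = x * (g * x⁻¹ * g⁻¹) := by simp [commutatorElement_def, mul_assoc]
    rw [this]
    exact mul_mem hx (hN.conj_mem _ (inv_mem hx) g)

instance PS_normal (n : ℕ) : (PS p G n).Normal := (PS_aux n).1

theorem PS_le (n : ℕ) : PS p G (n + 1) ≤ PS p G n := (PS_aux n).2

theorem PS_anti : Antitone (PS p G) := antitone_nat_of_succ_le PS_le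

theorem pow_mul_central {Q : Type} [Group Q] (x y t : Q) (h : y * x = x * y * t)
    (ht : ∀ z, z * t = t * z) (n : ℕ) : (x * y) ^ n = x ^ n * y ^ n * t ^ (n.choose 2) := by
  have hc : ∀ (m : ℕ) (z : Q), z * t ^ m = t ^ m * z := fun m z =>
    (Commute.pow_right (show Commute z t from ht z) m)
  have h1 : ∀ m : ℕ, y ^ m * x = x * y ^ m * t ^ m := by
    intro m
    induction m with
    | zero => simp
    | succ m ih =>
      calc y ^ (m + 1) * x = y ^ m * (y * x) := by rw [pow_succ]; group
        _ = (y ^ m * x) * y * t := by rw [h]; group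
        _ = x * y ^ m * (t ^ m * y) * t := by rw [ih]; group
        _ = x * y ^ (m + 1) * t ^ (m + 1) := by rw [← hc, pow_succ, pow_succ]; group
  induction n with
  | zero => simp
  | succ n ih =>
    calc (x * y) ^ (n + 1) = x ^ n * y ^ n * (t ^ (n.choose 2) * (x * y)) := by
          rw [pow_succ, ih]; group
      _ = x ^ n * (y ^ n * x) * y * t ^ (n.choose 2) := by rw [← hc]; group
      _ = x ^ n * x * y ^ n * (t ^ n * y) * t ^ (n.choose 2) := by rw [h1]; group
      _ = x ^ (n + 1) * y ^ (n + 1) * t ^ ((n + 1).choose 2) := by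
          rw [← hc, Nat.choose_succ_succ' n 1, Nat.choose_one_right, pow_add t, pow_succ, pow_succ]
          group

theorem PS_central {m : ℕ} {t : G} (ht : t ∈ PS p G m) (z : G ⧸ PS p G (m + 1)) :
    (t : G ⧸ PS p G (m + 1)) * z = z * (t : G ⧸ PS p G (m + 1)) := by
  induction z using QuotientGroup.induction_on with
  | H z =>
    rw [← QuotientGroup.mk_mul, ← QuotientGroup.mk_mul, QuotientGroup.eq]
    have h3 := inv_mem (PS_comm (inv_mem ht) z⁻¹)
    have : (t * z)⁻¹ * (z * t) = ⁅z⁻¹, t⁻¹⁆ := by simp [commutatorElement_def, mul_assoc]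
    rwa [this, ← commutatorElement_inv]

theorem PS_mulpow {m : ℕ} (hp : p.Prime) (x y : G)
    (h : (p ≠ 2 ∧ ⁅y⁻¹, x⁻¹⁆ ∈ PS p G m) ∨ ⁅y⁻¹, x⁻¹⁆ ∈ PS p G (m + 1)) :
    (((x * y) ^ p : G) : G ⧸ PS p G (m + 1)) = ((x ^ p * y ^ p : G) : G ⧸ PS p G (m + 1)) := by
  have hm : ⁅y⁻¹, x⁻¹⁆ ∈ PS p G m := h.elim (fun h => h.2) (fun h => PS_le m h)
  have hz : ∀ z : G ⧸ PS p G (m + 1), z * ((⁅y⁻¹, x⁻¹⁆ : G) : G ⧸ PS p G (m + 1))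
      = ((⁅y⁻¹, x⁻¹⁆ : G) : G ⧸ PS p G (m + 1)) * z := fun z => (PS_central hm z).symm
  have key := pow_mul_central (x : G ⧸ PS p G (m + 1)) (y : G ⧸ PS p G (m + 1)) _ (by
    rw [← QuotientGroup.mk_mul, ← QuotientGroup.mk_mul, ← QuotientGroup.mk_mul]
    congr 1
    show y * x = x * y * ⁅y⁻¹, x⁻¹⁆
    simp [commutatorElement_def, mul_assoc]) hz p
  rw [QuotientGroup.mk_pow, QuotientGroup.mk_mul, QuotientGroup.mk_mul, key,
    QuotientGroup.mk_pow, QuotientGroup.mk_pow]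
  rw [mul_eq_left]
  rcases h with h | h
  · obtain ⟨k, hk⟩ : p ∣ p.choose 2 :=
      hp.dvd_choose_self (by norm_num) (lt_of_le_of_ne hp.two_le (Ne.symm h.1))
    rw [hk, pow_mul, ← QuotientGroup.mk_pow, (QuotientGroup.eq_one_iff _).2 (PS_pow hm), one_pow]
  · rw [(QuotientGroup.eq_one_iff _).2 h, one_pow]

/-- the consequences of powerfulness for `p = 2` -/
theorem PS_two (hpow : IsPowerful 2 G) (n : ℕ) :
    ∀ x ∈ PS 2 G n, ∀ g : G, ⁅x, g⁆ ∈ PS 2 G (n + 2) := by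
  induction n with
  | zero =>
    intro x _ g
    have h1 : commutator G ≤ PS 2 G 2 := by
      rw [IsPowerful, if_pos rfl] at hpow
      refine hpow.trans ?_
      rw [Subgroup.closure_le]
      rintro _ ⟨g, rfl⟩
      have : g ^ 4 = (g ^ 2) ^ 2 := by rw [← pow_mul]
      rw [this]
      exact PS_pow (PS_pow (n := 0) (Subgroup.mem_top g))
    exact h1 (Subgroup.commutator_mem_commutator (Subgroup.mem_top x) (Subgroup.mem_top g))
  | succ n ih =>
    have hle : PS 2 G (n + 1) ≤ (Subgroup.center (G ⧸ PS 2 G (n + 3))).comap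
        (QuotientGroup.mk' (PS 2 G (n + 3))) := by
      have hc : ∀ y : G, (∀ g : G, ⁅y, g⁆ ∈ PS 2 G (n + 3)) → y ∈
          (Subgroup.center (G ⧸ PS 2 G (n + 3))).comap (QuotientGroup.mk' (PS 2 G (n + 3))) := by
        intro y hy
        rw [Subgroup.mem_comap, Subgroup.mem_center_iff]
        intro z
        induction z using QuotientGroup.induction_on with
        | H z =>
          have h := (QuotientGroup.eq_one_iff (N := PS 2 G (n + 3)) _).2 (hy z)
          rw [commutatorElement_def] at h
          simp only [QuotientGroup.mk_mul, QuotientGroup.mk_inv] at h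
          rw [QuotientGroup.mk'_apply]
          rw [mul_inv_eq_one, mul_inv_eq_iff_eq_mul] at h
          exact h.symm
      rw [PS_succ_le_iff]
      refine ⟨fun x hx => hc _ fun g => ?_, fun x hx g => hc _ fun g' => PS_comm (ih x hx g) g'⟩
      have hcm := ih x hx g
      have h1 : ⁅x ^ 2, g⁆ = ⁅x, ⁅x, g⁆⁆ * ⁅x, g⁆ ^ 2 := by
        simp [commutatorElement_def, mul_assoc, pow_two]
      rw [h1]
      refine mul_mem ?_ (PS_pow hcm)
      rw [← commutatorElement_inv]
      exact inv_mem (PS_comm hcm x)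
    intro x hx g
    have := hle hx
    rw [Subgroup.mem_comap, Subgroup.mem_center_iff] at this
    have h2 := this (QuotientGroup.mk' (PS 2 G (n + 3)) g)
    rw [← map_mul, ← map_mul] at h2
    rw [← QuotientGroup.eq_one_iff, commutatorElement_def]
    have h3 : x * g * x⁻¹ * g⁻¹ = (x * g) * (g * x)⁻¹ := by simp [mul_assoc]
    rw [h3, QuotientGroup.mk_mul, QuotientGroup.mk_inv, mul_inv_eq_one]
    exact h2.symm

/-- `p`-th power map is multiplicative `P n → P (n+1) / P (n+2)`. -/
theorem PS_hom (hp : p.Prime) (hpow : IsPowerful p G) {n : ℕ} {x : G} (y : G) (hx : x ∈ PS p G n)  :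
    (((x * y) ^ p : G) : G ⧸ PS p G (n + 2)) = ((x ^ p * y ^ p : G) : G ⧸ PS p G (n + 2)) := by
  refine PS_mulpow hp x y ?_
  by_cases h : p = 2
  · right
    subst h
    rw [← commutatorElement_inv]
    exact inv_mem (PS_two hpow n _ (inv_mem hx) _)
  · left
    refine ⟨h, ?_⟩
    rw [← commutatorElement_inv]
    exact inv_mem (PS_comm (inv_mem hx) _)

/-- Subgroup of elements of form `x ^ p * z`. -/
def PSimg (hp : p.Prime) (hpow : IsPowerful p G) (n : ℕ) : Subgroup G where
  carrier := {y | ∃ x ∈ PS p G n, (y : G ⧸ PS p G (n + 2)) = ((x ^ p : G) : G ⧸ PS p G (n + 2))}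
  one_mem' := ⟨1, one_mem _, by simp⟩
  mul_mem' := by
    rintro a b ⟨x, hx, h⟩ ⟨y, hy, h'⟩
    refine ⟨x * y, mul_mem hx hy, ?_⟩
    rw [PS_hom hp hpow y hx, QuotientGroup.mk_mul, QuotientGroup.mk_mul, h, h']
  inv_mem' := by
    rintro a ⟨x, hx, h⟩
    refine ⟨x⁻¹, inv_mem hx, ?_⟩
    rw [inv_pow, QuotientGroup.mk_inv, QuotientGroup.mk_inv, h]

theorem PS_le_img (hp : p.Prime) (hpow : IsPowerful p G) (n : ℕ) :
    PS p G (n + 1) ≤ PSimg hp hpow n := by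
  have hz : ∀ n, ∀ z ∈ PS p G (n + 2), z ∈ PSimg hp hpow n := fun n z hz =>
    ⟨1, one_mem _, by simpa using hz⟩
  have hq : ∀ n, ∀ z ∈ PS p G n, z ^ p ∈ PSimg hp hpow n := fun n z hz => ⟨z, hz, rfl⟩
  by_cases h2 : p = 2
  · subst h2
    rw [PS_succ_le_iff]
    exact ⟨hq n, fun x hx g => hz _ _ (PS_two hpow n x hx g)⟩
  induction n with
  | zero =>
    rw [PS_succ_le_iff]
    refine ⟨hq 0, fun x hx g => ?_⟩
    have h1 := hpow
    rw [IsPowerful, if_neg h2] at h1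
    have h3 : commutator G ≤ PSimg hp hpow 0 := by
      refine h1.trans ?_
      rw [Subgroup.closure_le]
      rintro _ ⟨g, rfl⟩
      exact hq 0 g (Subgroup.mem_top g)
    exact h3 (Subgroup.commutator_mem_commutator (Subgroup.mem_top x) (Subgroup.mem_top g))
  | succ n ih =>
    rw [PS_succ_le_iff]
    refine ⟨hq _, fun y hy g => ?_⟩
    -- conjugation
    obtain ⟨x, hx, hxy⟩ := ih hy
    -- c with g x g⁻¹ = x * c
    have hc : ⁅x⁻¹, g⁆ ∈ PS p G (n + 1) := PS_comm (inv_mem hx) g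
    have e1 : g * x * g⁻¹ = x * ⁅x⁻¹, g⁆ := by simp [commutatorElement_def, mul_assoc]
    have e2 := PS_mulpow (m := n + 2) hp x ⁅x⁻¹, g⁆ (Or.inl ⟨h2, PS_comm (inv_mem hc) _⟩)
    rw [← e1, conj_pow] at e2
    -- y = x^p * z
    have hzz := QuotientGroup.eq.1 hxy.symm
    set z := (x ^ p)⁻¹ * y with hzdef
    have hy' : y = x ^ p * z := by simp [hzdef]
    have hzc := PS_comm hzz g
    refine ⟨⁅x⁻¹, g⁆⁻¹, inv_mem hc, ?_⟩
    have e3 : ⁅y, g⁆ = x ^ p * ⁅z, g⁆ * (g * x ^ p * g⁻¹)⁻¹ := by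
      rw [hy']; simp [commutatorElement_def, mul_assoc]
    have e4 := (QuotientGroup.eq_one_iff _).2 hzc
    rw [e3, QuotientGroup.mk_mul, QuotientGroup.mk_mul, QuotientGroup.mk_inv]
    erw [e2, e4]
    rw [mul_one, inv_pow, ← QuotientGroup.mk_inv, ← QuotientGroup.mk_mul]
    simp only [mul_inv_rev, mul_assoc, QuotientGroup.mk_mul, QuotientGroup.mk_inv]
    have e5 : ((⁅x⁻¹, g⁆ ^ p : G) : G ⧸ PS p G (n + 3)) * ((x ^ p : G) : G ⧸ PS p G (n + 3))
        = ((x ^ p : G) : G ⧸ PS p G (n + 3)) * ((⁅x⁻¹, g⁆ ^ p : G) : G ⧸ PS p G (n + 3)) := by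
      exact PS_central (PS_pow hc) _
    have e6 := congrArg (fun t => t⁻¹) e5
    simp only [mul_inv_rev] at e6
    erw [← e6]
    exact mul_inv_cancel_left _ _
 
/-- Iterated power map is a hom. -/
theorem PS_iter (hp : p.Prime) (hpow : IsPowerful p G) (n : ℕ) :
    (∀ x : G, x ^ p ^ n ∈ PS p G n) ∧ (∀ x y : G,
    (((x * y) ^ p ^ n : G) : G ⧸ PS p G (n + 1)) =
      ((x ^ p ^ n * y ^ p ^ n : G) : G ⧸ PS p G (n + 1))) ∧
    (∀ y ∈ PS p G n, ∃ x : G, (y : G ⧸ PS p G (n + 1)) = ((x ^ p ^ n : G) : G ⧸ PS p G (n + 1))) := by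
  have hcong : ∀ n, ∀ a b : G, a ∈ PS p G n →
      (a : G ⧸ PS p G (n + 1)) = (b : G ⧸ PS p G (n + 1)) →
      ((a ^ p : G) : G ⧸ PS p G (n + 2)) = ((b ^ p : G) : G ⧸ PS p G (n + 2)) := by
    intro n a b ha h
    have hz := QuotientGroup.eq.1 h
    have hb : b = a * (a⁻¹ * b) := by simp
    rw [hb, PS_hom hp hpow _ ha, QuotientGroup.mk_mul, (QuotientGroup.eq_one_iff _).2 (PS_pow hz),
      mul_one]
  induction n with
  | zero => exact ⟨fun x => Subgroup.mem_top _, fun x y => by simp, fun y _ => ⟨y, by simp⟩⟩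
  | succ n ih =>
    obtain ⟨h1, h2, h3⟩ := ih
    refine ⟨fun x => ?_, fun x y => ?_, fun y hy => ?_⟩
    · rw [pow_succ, pow_mul]; exact PS_pow (h1 x)
    · simp only [pow_succ p n, pow_mul]
      rw [hcong n _ _ (h1 _) (h2 x y), PS_hom hp hpow _ (h1 x)]
    · obtain ⟨x, hx, hxy⟩ := PS_le_img hp hpow n hy
      obtain ⟨w, hw⟩ := h3 x hx
      refine ⟨w, ?_⟩
      rw [pow_succ, pow_mul, hxy]
      exact hcong n _ _ hx hw

/-- The iterated power homomorphism. -/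
def PSf (hp : p.Prime) (hpow : IsPowerful p G) (n : ℕ) : G →* G ⧸ PS p G (n + 1) :=
  MonoidHom.mk' (fun x => ((x ^ p ^ n : G) : G ⧸ PS p G (n + 1))) (fun x y => by
    rw [(PS_iter hp hpow n).2.1 x y, QuotientGroup.mk_mul])

theorem PS_mk_comm {n : ℕ} {a b : G} (ha : a ∈ PS p G n) :
    ((⁅a, b⁆ : G) : G ⧸ PS p G (n + 1)) = 1 := (QuotientGroup.eq_one_iff _).2 (PS_comm ha b)

theorem PS_stab [Finite G] (hp : p.Prime) (hG : IsPGroup p G) {n : ℕ}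
    (h : PS p G n ≤ PS p G (n + 1)) : PS p G n = ⊥ := by
  haveI : Fact p.Prime := ⟨hp⟩
  have hnil : Group.IsNilpotent G := hG.isNilpotent
  obtain ⟨c, hc⟩ := Subgroup.nilpotent_iff_lowerCentralSeries.1 hnil
  have key : ∀ k, PS p G n ≤ Subgroup.lowerCentralSeries ⊤ k := by
    intro k
    induction k with
    | zero => exact le_top
    | succ k ih =>
      set L := Subgroup.lowerCentralSeries (⊤ : Subgroup G) (k + 1) with hL
      have hcomm : ∀ x ∈ PS p G n, ∀ g : G, ⁅x, g⁆ ∈ L := fun x hx g =>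
        Subgroup.commutator_mem_commutator (ih hx) (Subgroup.mem_top g)
      let φ : PS p G n →* G ⧸ L := MonoidHom.mk' (fun x => ((x : G) : G ⧸ L) ^ p) (by
        intro a b
        have : Commute ((a : G) : G ⧸ L) ((b : G) : G ⧸ L) := by
          rw [← commutatorElement_eq_one_iff_commute]
          exact (QuotientGroup.eq_one_iff _).2 (hcomm a a.2 b)
        rw [Subgroup.coe_mul, QuotientGroup.mk_mul, this.mul_pow])
      have h1 : PS p G n ≤ φ.range.comap (QuotientGroup.mk' L) := by
        refine h.trans ?_
        rw [PS_succ_le_iff]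
        refine ⟨fun x hx => ⟨⟨x, hx⟩, rfl⟩, fun x hx g => ?_⟩
        rw [Subgroup.mem_comap]
        have : QuotientGroup.mk' L ⁅x, g⁆ = 1 := (QuotientGroup.eq_one_iff _).2 (hcomm x hx g)
        rw [this]
        exact one_mem _
      have h2 : ∀ j, ∀ a ∈ PS p G n, ∃ b ∈ PS p G n, (a : G ⧸ L) = (b : G ⧸ L) ^ p ^ j := by
        intro j
        induction j with
        | zero => exact fun a ha => ⟨a, ha, by simp⟩
        | succ j ihj =>
          intro a ha
          obtain ⟨b, hb, hab⟩ := ihj a ha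
          obtain ⟨⟨b', hb'⟩, hbb⟩ := h1 hb
          refine ⟨b', hb', ?_⟩
          rw [hab, pow_succ', pow_mul]
          congr 1
          exact hbb.symm
      intro a ha
      obtain ⟨m, hm⟩ := IsPGroup.iff_card.1 hG
      obtain ⟨b, hb, hab⟩ := h2 m a ha
      rw [← QuotientGroup.eq_one_iff, hab, ← QuotientGroup.mk_pow, ← hm, pow_card_eq_one']
      rfl
  exact le_bot_iff.1 (hc ▸ key c)

theorem PS_term [Finite G] (hp : p.Prime) (hG : IsPGroup p G) : ∃ n, PS p G n = ⊥ := by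
  by_contra! hne
  have : ∀ n, Nat.card (PS p G n) + n ≤ Nat.card G := by
    intro n
    induction n with
    | zero => simpa using Subgroup.card_le_card_group _
    | succ n ih =>
      have hlt : PS p G (n + 1) < PS p G n := by
        refine lt_of_le_not_ge (PS_le n) (fun h => hne n (PS_stab hp hG h))
      have : Nat.card (PS p G (n + 1)) < Nat.card (PS p G n) :=
        Set.Finite.card_lt_card (Set.toFinite _) hlt
      omega
  have h1 := this (Nat.card G)
  have h2 : 0 < Nat.card (PS p G (Nat.card G)) := Nat.card_pos
  omega

theorem PS_index_one [Finite G] : (PS p G 1).index ≤ p ^ minGens G ∨ p = 0 := by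
  by_cases hp0 : p = 0
  · exact Or.inr hp0
  left
  have hne : {n : ℕ | ∃ S : Finset G, S.card = n ∧ Subgroup.closure (S : Set G) = ⊤}.Nonempty :=
    ⟨_, Set.toFinite (Set.univ : Set G) |>.toFinset, rfl, by simp⟩
  obtain ⟨S, hS, hS'⟩ := Nat.sInf_mem hne
  have hr : Group.rank G ≤ minGens G := (Group.rank_le hS').trans hS.le
  letI : CommGroup (G ⧸ PS p G 1) :=
    { (inferInstance : Group (G ⧸ PS p G 1)) with
      mul_comm := by
        intro a b
        induction a using QuotientGroup.induction_on with
        | H a => exact PS_central (m := 0) (Subgroup.mem_top a) b }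
  have h1 : Nat.card (G ⧸ PS p G 1) ∣ p ^ Group.rank (G ⧸ PS p G 1) := by
    apply card_dvd_exponent_pow_rank'
    intro g
    induction g using QuotientGroup.induction_on with
    | H g => exact (QuotientGroup.eq_one_iff _).2 (PS_pow (n := 0) (Subgroup.mem_top g))
  have h2 : Group.rank (G ⧸ PS p G 1) ≤ Group.rank G :=
    Group.rank_le_of_surjective (QuotientGroup.mk' (PS p G 1)) (QuotientGroup.mk'_surjective _)
  have hpos : 0 < p := Nat.pos_of_ne_zero hp0
  exact (Nat.le_of_dvd (pow_pos hpos _) h1).trans (Nat.pow_le_pow_right hpos (h2.trans hr))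

theorem PSf_ker (hp : p.Prime) (hpow : IsPowerful p G) (n : ℕ) :
    PS p G 1 ≤ (PSf hp hpow n).ker := by
  have := (PS_iter hp hpow n).1
  rw [PS_succ_le_iff]
  refine ⟨fun x _ => ?_, fun x _ g => ?_⟩
  · rw [MonoidHom.mem_ker]
    refine (QuotientGroup.eq_one_iff _).2 ?_
    rw [← pow_mul, ← pow_succ']
    exact (PS_iter hp hpow (n + 1)).1 x
  · rw [MonoidHom.mem_ker, map_commutatorElement]
    exact PS_mk_comm (this x)

theorem PSf_range (hp : p.Prime) (hpow : IsPowerful p G) (n : ℕ) :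
    (PS p G n).map (QuotientGroup.mk' (PS p G (n + 1))) ≤ (PSf hp hpow n).range := by
  rintro _ ⟨y, hy, rfl⟩
  obtain ⟨x, hx⟩ := (PS_iter hp hpow n).2.2 y hy
  exact ⟨x, hx.symm⟩

theorem PS_index [Finite G] (hp : p.Prime) (hpow : IsPowerful p G) (n : ℕ) :
    (PS p G n).index ≤ (p ^ minGens G) ^ n := by
  induction n with
  | zero => simp [PS]
  | succ n ih =>
    rw [← Subgroup.relIndex_mul_index (PS_le n), pow_succ']
    refine Nat.mul_le_mul ?_ ih
    have h1 : (PS p G (n + 1)).relIndex (PS p G n) =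
        Nat.card ((PS p G n).map (QuotientGroup.mk' (PS p G (n + 1)))) := by
      rw [← Subgroup.relIndex_ker, QuotientGroup.ker_mk']
    rw [h1]
    refine (Subgroup.card_le_of_le (PSf_range hp hpow n)).trans ?_
    rw [← Subgroup.index_ker]
    refine le_trans ?_ ((PS_index_one (p := p) (G := G)).resolve_right hp.ne_zero)
    exact Nat.le_of_dvd (Nat.pos_of_ne_zero Subgroup.index_ne_zero_of_finite)
      (Subgroup.index_dvd_of_le (PSf_ker hp hpow n))

/-- The main count. -/
theorem PS_count [Finite G] (hp : p.Prime) (hG : IsPGroup p G) (hpow : IsPowerful p G) {n : ℕ}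
    (h0 : PS p G n ≠ ⊥) (h1 : PS p G (n + 1) = ⊥) :
    (p - 1) * p ^ (n + 1) ≤ p * Nat.card (ConjClasses G) := by
  haveI : Fact p.Prime := ⟨hp⟩
  set K := (PSf hp hpow n).ker with hK
  have hKtop : K ≠ ⊤ := by
    intro hKt
    apply h0
    rw [eq_bot_iff, ← h1]
    intro y hy
    obtain ⟨x, hx⟩ := (PS_iter hp hpow n).2.2 y hy
    have : x ∈ K := hKt ▸ Subgroup.mem_top x
    rw [← QuotientGroup.eq_one_iff, hx]
    exact this
  have hord : ∀ x : G, x ∉ K → p ^ (n + 1) = orderOf x := by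
    intro x hx
    symm
    apply orderOf_eq_prime_pow
    · intro hx1
      apply hx
      rw [hK, MonoidHom.mem_ker]
      show ((x ^ p ^ n : G) : G ⧸ PS p G (n + 1)) = 1
      rw [hx1]; rfl
    · have := (PS_iter hp hpow (n + 1)).1 x
      rw [h1] at this
      exact this
  have hidx : p ≤ K.index := by
    obtain ⟨m, hm⟩ := (IsPGroup.iff_card.1 hG)
    have hd : K.index ∣ p ^ m := hm ▸ K.index_dvd_card
    obtain ⟨j, _, hj⟩ := (Nat.dvd_prime_pow hp).1 hd
    rcases j with _ | j
    · exact absurd (Subgroup.index_eq_one.1 (by simpa using hj)) hKtop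
    · rw [hj, pow_succ]
      exact Nat.le_mul_of_pos_left _ (pow_pos hp.pos _)
  let F : {x : G // x ∉ K} × Fin (p ^ (n + 1)) → {q : G × G // Commute q.1 q.2} :=
    fun q => ⟨(q.1, (q.1 : G) ^ (q.2 : ℕ)), Commute.pow_right (Commute.refl _) _⟩
  have hF : Function.Injective F := by
    rintro ⟨⟨x, hx⟩, i⟩ ⟨⟨y, hy⟩, j⟩ h
    simp only [F, Subtype.mk.injEq, Prod.mk.injEq] at h
    obtain ⟨rfl, h⟩ := h
    have := pow_injOn_Iio_orderOf (x := x) (by rw [← hord x hx]; exact i.2)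
      (by rw [← hord x hx]; exact j.2) h
    simp only [Prod.mk.injEq, true_and]
    exact Fin.ext this
  have hc := Nat.card_le_card_of_injective F hF
  rw [card_comm_eq_card_conjClasses_mul_card, Nat.card_prod, Nat.card_fin] at hc
  have hsum : Nat.card {x : G // x ∉ K} + Nat.card K = Nat.card G := by
    classical
    rw [← Nat.card_sum]
    exact Nat.card_congr ((Equiv.sumComm _ _).trans (Equiv.sumCompl (fun x => x ∈ K)))
  have hmul := K.card_mul_index
  have hpos : 0 < Nat.card G := Nat.card_pos
  have hKp : p * Nat.card K ≤ Nat.card G := by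
    rw [← hmul, mul_comm]; exact Nat.mul_le_mul_left _ hidx
  obtain ⟨r, rfl⟩ : ∃ r, p = r + 1 := ⟨p - 1, by have := hp.pos; omega⟩
  simp only [Nat.add_sub_cancel]
  generalize Nat.card {x : G // x ∉ K} = a at *
  generalize Nat.card K = b at *
  generalize Nat.card G = g at *
  generalize Nat.card (ConjClasses G) = k at *
  generalize (r + 1) ^ (n + 1) = P at *
  have h3 : r * g ≤ (r + 1) * a := by nlinarith
  refine Nat.le_of_mul_le_mul_right ?_ hpos
  calc r * P * g = (r * g) * P := by ring
    _ ≤ ((r + 1) * a) * P := Nat.mul_le_mul_right _ h3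
    _ = (r + 1) * (a * P) := by ring
    _ ≤ (r + 1) * (k * g) := Nat.mul_le_mul_left _ hc
    _ = (r + 1) * k * g := by ring

end Aux

theorem stmt12 (p : ℕ) (hp : p.Prime) (G : Type) [Group G] [Finite G]
    (hG : IsPGroup p G) (hpow : IsPowerful p G) :
    (1 - (p : ℝ)⁻¹) * (Nat.card G : ℝ) ^ ((1 : ℝ) / (minGens G : ℝ))
      ≤ (Nat.card (ConjClasses G) : ℝ) := by
  classical
  have hp0 : (0 : ℝ) < p := by exact_mod_cast hp.pos
  have hp1 : (1 : ℝ) ≤ p := by exact_mod_cast hp.one_le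
  have hinv : 0 ≤ 1 - (p : ℝ)⁻¹ := sub_nonneg.2 (inv_le_one_of_one_le₀ hp1)
  have hk : (1 : ℝ) ≤ (Nat.card (ConjClasses G) : ℝ) := by
    have : 0 < Nat.card (ConjClasses G) := Nat.card_pos
    exact_mod_cast this
  have htriv : (Nat.card G : ℝ) ^ ((1 : ℝ) / (minGens G : ℝ)) = 1 →
      (1 - (p : ℝ)⁻¹) * (Nat.card G : ℝ) ^ ((1 : ℝ) / (minGens G : ℝ))
      ≤ (Nat.card (ConjClasses G) : ℝ) := by
    intro h
    rw [h]
    have : 0 < (p : ℝ)⁻¹ := by positivity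
    linarith
  by_cases hd : minGens G = 0
  · apply htriv; simp [hd]
  have hex := PS_term hp hG
  have hmin := fun m => Nat.find_min (H := hex) (m := m)
  have hspec := Nat.find_spec hex
  have hidx := PS_index hp hpow (Nat.find hex)
  rw [hspec, Subgroup.index_bot] at hidx
  generalize Nat.find hex = e at *
  rcases e with _ | n
  · apply htriv
    have : Nat.card G = 1 := le_antisymm (by simpa using hidx) Nat.card_pos
    simp [this]
  have hcount := PS_count hp hG hpow (hmin n (Nat.lt_succ_self n)) hspec
  have hd0 : (minGens G : ℝ) ≠ 0 := by exact_mod_cast hd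
  have hle : (Nat.card G : ℝ) ^ ((1 : ℝ) / (minGens G : ℝ)) ≤ (p : ℝ) ^ (n + 1) := by
    have h1 : (Nat.card G : ℝ) ≤ ((p : ℝ) ^ (n + 1)) ^ (minGens G) := by
      rw [← pow_mul, mul_comm, pow_mul]
      exact_mod_cast hidx
    calc (Nat.card G : ℝ) ^ ((1 : ℝ) / (minGens G : ℝ))
        ≤ (((p : ℝ) ^ (n + 1)) ^ (minGens G)) ^ ((1 : ℝ) / (minGens G : ℝ)) :=
          Real.rpow_le_rpow (by positivity) h1 (by positivity)
      _ = (p : ℝ) ^ (n + 1) := by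
          rw [one_div, Real.pow_rpow_inv_natCast (by positivity) hd]
  refine (mul_le_mul_of_nonneg_left hle hinv).trans ?_
  have hcount' : ((p : ℝ) - 1) * (p : ℝ) ^ (n + 1) ≤ p * (Nat.card (ConjClasses G) : ℝ) := by
    have : (((p - 1 : ℕ) : ℝ)) * (p : ℝ) ^ (n + 1) ≤ p * (Nat.card (ConjClasses G) : ℝ) := by
      exact_mod_cast hcount
    rwa [Nat.cast_sub hp.one_le, Nat.cast_one] at this
  have h5 : (1 - (p : ℝ)⁻¹) * (p : ℝ) ^ (n + 1) = (((p : ℝ) - 1) * (p : ℝ) ^ (n + 1)) / p := by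
    field_simp
  rw [h5, div_le_iff₀ hp0, mul_comm (Nat.card (ConjClasses G) : ℝ)]
  exact hcount'
end
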